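/- arXiv:0907.0724 — 2 statements merged into one kernel-verified Lean document; each statement's English description precedes it below -/
import Mathlib

section
/- Let S be a set of n points in ℝ³, no three collinear, such that every plane contains at most n − k points of S, where k ≥ 1. If n ≥ 54k² + (9/2)k, then the total number m of planes determined by S satisfies m ≥ 1 + k·C(n−k,2) − C(k,2)·(n−k)/2 (as an inequality of real numbers). -/
open Set

noncomputable section

/-- Three-dimensional euclidean space. -/
abbrev Pt3 := EuclideanSpace ℝ (Fin 3)

/-- A plane in space: the affine span of three affinely independent points. -/
def IsPlane (P : Set Pt3) : Prop :=
  ∃ a b c : Pt3, AffineIndependent ℝ ![a, b, c] ∧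
    P = (affineSpan ℝ ({a, b, c} : Set Pt3) : Set Pt3)

/-- `planeCount S k` is the number of planes containing exactly `k` points of `S`. -/
def planeCount (S : Set Pt3) (k : ℕ) : ℕ :=
  {P : Set Pt3 | IsPlane P ∧ (S ∩ P).ncard = k}.ncard

/-- The planes determined by `S`: planes containing at least three points of `S`. -/
def detPlanes (S : Set Pt3) : Set (Set Pt3) :=
  {P : Set Pt3 | IsPlane P ∧ 3 ≤ (S ∩ P).ncard}

/-- No three points of `S` are collinear. -/
def NoThreeCollinear (S : Set Pt3) : Prop :=
  ∀ T ⊆ S, T.ncard = 3 → ¬ Collinear ℝ T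

theorem sum_card_incidence_le {ι V : Type*} (L : Finset ι) (D : Finset V) (a b : ι → ℝ)
    (x y : V → ℝ) (ha : ∀ i ∈ L, ∀ j ∈ L, a i = a j → i = j)
    (hxy : ∀ v ∈ D, ∀ w ∈ D, x v = x w → y v = y w → v = w)
    (hD : ∀ i ∈ L, ∀ j ∈ L, i ≠ j →
      ∃ v ∈ D, y v = a i * x v + b i ∧ y v = a j * x v + b j) :
    ∑ v ∈ D, (L.filter fun i => y v = a i * x v + b i).card ≤ 3 * D.card + L.card := by
  classical
  set On : ι → V → Prop := fun i v => y v = a i * x v + b i with hOn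
  have hline : ∀ i, ∀ v ∈ D, ∀ w ∈ D, On i v → On i w → x v = x w → v = w := by
    intro i v hv w hw h1 h2 h
    exact hxy v hv w hw h (by simp only [hOn] at h1 h2; rw [h1, h2, h])
  -- the vertex `w` directly follows `v` on the line `i`
  let Next : ι → V → V → Prop := fun i v w => On i v ∧ On i w ∧ x v < x w ∧
    ∀ w' ∈ D, On i w' → x v < x w' → x w ≤ x w'
  have hNextEx : ∀ i v, On i v → ∀ w ∈ D, On i w → x v < x w → 
      ∃ w₀ ∈ D, Next i v w₀ ∧ x w₀ ≤ x w := by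
    intro i v hv w hw h1 h2
    obtain ⟨w₀, hw₀, hmin⟩ := (D.filter fun w => On i w ∧ x v < x w).exists_min_image x
      ⟨w, by simp [hw, h1, h2]⟩
    simp only [Finset.mem_filter] at hw₀ hmin
    exact ⟨w₀, hw₀.1, ⟨hv, hw₀.2.1, hw₀.2.2, fun w' a b c => hmin w' ⟨a, b, c⟩⟩,
      hmin w ⟨hw, h1, h2⟩⟩
  have hNextInj : ∀ i, ∀ v ∈ D, ∀ v' ∈ D, ∀ w ∈ D, Next i v w → Next i v' w → v = v' := by
    rintro i v hv v' hv' w hw ⟨h1, h2, h3, h4⟩ ⟨h1', h2', h3', h4'⟩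
    apply hline i v hv v' hv' h1 h1'
    by_contra hne
    rcases lt_or_gt_of_ne hne with h | h
    · exact absurd (h4 v' hv' h1' h) (not_le.mpr h3')
    · exact absurd (h4' v hv h1 h) (not_le.mpr h3)
  let Succ : V → ι → ι → Prop := fun v i i' => i' ∈ L ∧ On i v ∧ On i' v ∧ a i < a i' ∧
    ∀ j ∈ L, On j v → a i < a j → a i' ≤ a j
  let F := (D ×ˢ L).filter fun p => On p.2 p.1
  have hF : ∑ v ∈ D, (L.filter fun i => y v = a i * x v + b i).card = F.card := by
    simp only [F, Finset.card_filter, Finset.sum_product, hOn]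
  let F₀ := F.filter fun p => ∀ j ∈ L, On j p.1 → a j ≤ a p.2
  let F₁ := F.filter fun p => ∃ w ∈ D, Next p.2 p.1 w ∧ ∀ j ∈ L, On j w → a p.2 ≤ a j
  let F₂ := F.filter fun p => ∃ w ∈ D, ∃ i', Succ p.1 p.2 i' ∧ Next i' p.1 w ∧
    ∀ j ∈ L, On j w → a j ≤ a i'
  let F₃ := F.filter fun p => ∀ w ∈ D, On p.2 w → x w ≤ x p.1
  have memF : ∀ p, p ∈ F ↔ (p.1 ∈ D ∧ p.2 ∈ L) ∧ On p.2 p.1 := by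
    intro p; simp [F]
  have c₀ : F₀.card ≤ D.card := by
    apply Finset.card_le_card_of_forall_subsingleton (fun p v => p.1 = v)
    · intro p hp
      exact ⟨p.1, ((memF p).1 (Finset.mem_filter.1 hp).1).1.1, rfl⟩
    · rintro v - ⟨v1, i⟩ ⟨h1, e1⟩ ⟨v2, j⟩ ⟨h2, e2⟩
      simp only [F₀, Finset.mem_filter, memF] at h1 h2 e1 e2
      subst e1 e2
      rw [ha i h1.1.1.2 j h2.1.1.2 (le_antisymm (h2.2 i h1.1.1.2 h1.1.2) (h1.2 j h2.1.1.2 h2.1.2))]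
  have c₁ : F₁.card ≤ D.card := by
    apply Finset.card_le_card_of_forall_subsingleton
      (fun p w => Next p.2 p.1 w ∧ ∀ j ∈ L, On j w → a p.2 ≤ a j)
    · intro p hp
      exact (Finset.mem_filter.1 hp).2
    · rintro w hw ⟨v1, i⟩ ⟨h1, e1, f1⟩ ⟨v2, j⟩ ⟨h2, e2, f2⟩
      simp only [F₁, Finset.mem_filter, memF] at h1 h2 e1 e2 f1 f2
      obtain rfl := ha i h1.1.1.2 j h2.1.1.2
        (le_antisymm (f1 j h2.1.1.2 e2.2.1) (f2 i h1.1.1.2 e1.2.1))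
      rw [hNextInj i v1 h1.1.1.1 v2 h2.1.1.1 w hw e1 e2]
  have c₂ : F₂.card ≤ D.card := by
    apply Finset.card_le_card_of_forall_subsingleton
      (fun p w => ∃ i', Succ p.1 p.2 i' ∧ Next i' p.1 w ∧ ∀ j ∈ L, On j w → a j ≤ a i')
    · intro p hp
      exact (Finset.mem_filter.1 hp).2
    · rintro w hw ⟨v1, i⟩ ⟨h1, i', s1, e1, f1⟩ ⟨v2, j⟩ ⟨h2, j', s2, e2, f2⟩
      simp only [F₂, Finset.mem_filter, memF] at h1 h2 s1 s2 e1 e2 f1 f2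
      obtain rfl := ha i' s1.1 j' s2.1
        (le_antisymm (f2 i' s1.1 e1.2.1) (f1 j' s2.1 e2.2.1))
      obtain rfl := hNextInj i' v1 h1.1.1.1 v2 h2.1.1.1 w hw e1 e2
      obtain ⟨-, o1, -, l1, m1⟩ := s1
      obtain ⟨-, o2, -, l2, m2⟩ := s2
      have : a i = a j := by
        by_contra hne
        rcases lt_or_gt_of_ne hne with h | h
        · linarith [m1 j h2.1.1.2 o2 h]
        · linarith [m2 i h1.1.1.2 o1 h]
      rw [ha i h1.1.1.2 j h2.1.1.2 this]
  have c₃ : F₃.card ≤ L.card := by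
    apply Finset.card_le_card_of_forall_subsingleton (fun p i => p.2 = i)
    · intro p hp
      exact ⟨p.2, ((memF p).1 (Finset.mem_filter.1 hp).1).1.2, rfl⟩
    · rintro v - ⟨v1, i⟩ ⟨h1, e1⟩ ⟨v2, j⟩ ⟨h2, e2⟩
      simp only [F₃, Finset.mem_filter, memF] at h1 h2 e1 e2
      subst e1 e2
      rw [hline j v1 h1.1.1.1 v2 h2.1.1.1 h1.1.2 h2.1.2
        (le_antisymm (h2.2 v1 h1.1.1.1 h1.1.2) (h1.2 v2 h2.1.1.1 h2.1.2))]
  have hcover : F ⊆ F₀ ∪ (F₁ ∪ (F₂ ∪ F₃)) := by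
    rintro ⟨v, i⟩ hp
    obtain ⟨⟨hv, hi⟩, hiv⟩ := (memF _).1 hp
    simp only at hv hi hiv
    by_contra hcon
    simp only [Finset.mem_union, F₀, F₁, F₂, F₃, Finset.mem_filter, hp, true_and, not_or] at hcon
    obtain ⟨n₀, n₁, n₂, n₃⟩ := hcon
    push Not at n₀ n₁ n₂ n₃
    -- the line `i'` following `i` in the order of slopes at `v`
    obtain ⟨j, hj, hjv, hij⟩ := n₀
    obtain ⟨i', hi', hmin⟩ := (L.filter fun j => On j v ∧ a i < a j).exists_min_image a
      ⟨j, by simp [hj, hjv, hij]⟩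
    simp only [Finset.mem_filter] at hi' hmin
    obtain ⟨hi'L, hi'v, hii'⟩ := hi'
    have hsucc : Succ v i i' := ⟨hi'L, hiv, hi'v, hii', fun j h1 h2 h3 => hmin j ⟨h1, h2, h3⟩⟩
    obtain ⟨w, hw, hiw, hvw⟩ := n₃
    obtain ⟨w, hw, hnext, -⟩ := hNextEx i v hiv w hw hiw hvw
    obtain ⟨h, hh, hhw, hah⟩ := n₁ w hw hnext
    -- a line through a vertex of `i` (resp. `i'`) cutting the face also cuts `i'` (resp. `i`)
    have key : ∀ h ∈ L, ∀ g ∈ L, ∀ w ∈ D, h ≠ g → On h w → x v < x w →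
        0 < ((a h - a g) * x v + (b h - b g)) * ((y w) - (a g * x w + b g)) * (-1) →
        ∃ u ∈ D, On g u ∧ x v < x u ∧ x u < x w := by
      intro h hh g hg w hw hne hhw hvw hsgn
      obtain ⟨u, hu, hgu, hhu⟩ := hD g hg h hh hne.symm
      refine ⟨u, hu, hgu, ?_⟩
      simp only [hOn] at hhw
      have hcross : (a h - a g) * x u + (b h - b g) = 0 := by linarith
      have e1 : (a h - a g) * x v + (b h - b g) = (a h - a g) * (x v - x u) := by linarith
      have e2 : y w - (a g * x w + b g) = (a h - a g) * (x w - x u) := by linarith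
      rw [e1, e2] at hsgn
      have : 0 < (a h - a g) ^ 2 * ((x u - x v) * (x w - x u)) := by nlinarith
      have := pos_of_mul_pos_right this (sq_nonneg _)
      rcases pos_and_pos_or_neg_and_neg_of_mul_pos this with h | h
      · constructor <;> linarith
      · linarith
    simp only [hOn] at hiv hi'v
    have hlow : ∃ u ∈ D, On i' u ∧ x v < x u ∧ x u < x w := by
      obtain ⟨-, hiw, hvw, -⟩ := hnext
      simp only [hOn] at hhw hiw
      apply key h hh i' hi'L w hw (by rintro rfl; linarith) hhw hvw
      have t1 : 0 < (a h - a i') * x v + (b h - b i') := by nlinarith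
      have t2 : 0 < -(y w - (a i' * x w + b i')) := by nlinarith
      nlinarith
    obtain ⟨u, hu, hi'u, hvu, huw⟩ := hlow
    obtain ⟨w', hw', hnext', hw'u⟩ := hNextEx i' v hi'v u hu hi'u hvu
    obtain ⟨h', hh', hhw', hah'⟩ := n₂ w' hw' i' hsucc hnext'
    have hhigh : ∃ u ∈ D, On i u ∧ x v < x u ∧ x u < x w' := by
      obtain ⟨-, hiw, hvw, -⟩ := hnext'
      simp only [hOn] at hhw' hiw
      apply key h' hh' i hi w' hw' (by rintro rfl; linarith) hhw' hvw
      have t1 : 0 < -((a h' - a i) * x v + (b h' - b i)) := by nlinarith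
      have t2 : 0 < (y w' - (a i * x w' + b i)) := by nlinarith
      nlinarith
    obtain ⟨u', hu', hiu', hvu', hu'w'⟩ := hhigh
    have := hnext.2.2.2 u' hu' hiu' hvu'
    linarith
  have := Finset.card_le_card hcover
  have := Finset.card_union_le F₀ (F₁ ∪ (F₂ ∪ F₃))
  have := Finset.card_union_le F₁ (F₂ ∪ F₃)
  have := Finset.card_union_le F₂ F₃
  rw [hF]
  omega

section Blocks

open Finset
variable {α : Type*} [DecidableEq α]

theorem card_le_of_pencil {D : Finset (Finset α)}
    (hinter : ∀ B ∈ D, ∀ B' ∈ D, B ≠ B' → (B ∩ B').card ≤ 2) {B : Finset α} (hB : B ∈ D)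
    {q q' : α} (hq : q ∉ B) (hq' : q' ∉ B) (hne : q ≠ q') :
    2 * ((B.powersetCard 2).filter fun e => ∃ B' ∈ D, e ⊆ B' ∧ q ∈ B' ∧ q' ∈ B').card
      ≤ B.card := by
  set E := (B.powersetCard 2).filter fun e => ∃ B' ∈ D, e ⊆ B' ∧ q ∈ B' ∧ q' ∈ B' with hE
  have hdis : ∀ e ∈ E, ∀ f ∈ E, e ≠ f → Disjoint e f := by
    intro e he f hf hef
    simp only [hE, mem_filter, mem_powersetCard] at he hf
    obtain ⟨⟨heB, hec⟩, P, hP, heP, hqP, hq'P⟩ := he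
    obtain ⟨⟨hfB, hfc⟩, Q, hQ, hfQ, hqQ, hq'Q⟩ := hf
    rw [Finset.disjoint_left]
    intro z hze hzf
    have hPQ : P = Q := by
      by_contra hPQ
      have h3 : ({z, q, q'} : Finset α) ⊆ P ∩ Q := by
        intro t ht
        simp only [Finset.mem_insert, Finset.mem_singleton] at ht
        rcases ht with rfl | rfl | rfl
        · exact Finset.mem_inter.2 ⟨heP hze, hfQ hzf⟩
        · exact Finset.mem_inter.2 ⟨hqP, hqQ⟩
        · exact Finset.mem_inter.2 ⟨hq'P, hq'Q⟩
      have hc : ({z, q, q'} : Finset α).card = 3 := by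
        rw [card_eq_three]
        exact ⟨z, q, q', fun h => hq (h ▸ heB hze), fun h => hq' (h ▸ heB hze), hne, rfl⟩
      have := Finset.card_le_card h3
      have := hinter P hP Q hQ hPQ
      omega
    subst hPQ
    have hsub : e ∪ f ⊆ B ∩ P := by
      intro t ht
      rcases Finset.mem_union.1 ht with h | h
      · exact Finset.mem_inter.2 ⟨heB h, heP h⟩
      · exact Finset.mem_inter.2 ⟨hfB h, hfQ h⟩
    have h1 := Finset.card_le_card hsub
    have h2 := hinter B hB P hP (fun h => hq (h ▸ hqP))
    have h4 : e = e ∪ f := eq_of_subset_of_card_le subset_union_left (by omega)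
    have h5 : f = e ∪ f := eq_of_subset_of_card_le subset_union_right (by omega)
    exact hef (h4.trans h5.symm)
  have hU : (E.biUnion id).card = ∑ e ∈ E, e.card := card_biUnion hdis
  have hs : ∑ e ∈ E, e.card = E.card * 2 := by
    apply sum_const_nat
    intro e he
    simp only [hE, mem_filter, mem_powersetCard] at he
    exact he.1.2
  have hle : E.biUnion id ⊆ B := by
    intro t ht
    simp only [Finset.mem_biUnion, id] at ht
    obtain ⟨e, he, hte⟩ := ht
    simp only [hE, mem_filter, mem_powersetCard] at he
    exact he.1.1 hte
  have := Finset.card_le_card hle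
  omega

theorem card_blocks_meeting_ge {S : Finset α} {D : Finset (Finset α)}
    (hcover : ∀ T ⊆ S, T.card = 3 → ∃ B ∈ D, T ⊆ B)
    (hinter : ∀ B ∈ D, ∀ B' ∈ D, B ≠ B' → (B ∩ B').card ≤ 2)
    {B : Finset α} (hB : B ∈ D) (hBS : B ⊆ S) (X : Finset α) (hX : X ⊆ S \ B) :
    (X.card : ℝ) * (B.card * (B.card - 1) / 2) - (X.card * (X.card - 1) / 2) * B.card / 2 ≤
      ((D.filter fun B' => (B' ∩ B).card = 2 ∧ (B' ∩ X).Nonempty).card : ℝ) := by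
  induction X using Finset.induction_on with
  | empty => simp
  | insert q X hqX ih =>
    have hX' : X ⊆ S \ B := (Finset.subset_insert q X).trans hX
    have hqS := Finset.mem_sdiff.1 (hX (Finset.mem_insert_self q X))
    specialize ih hX'
    set Y := D.filter fun B' => (B' ∩ B).card = 2 ∧ (B' ∩ X).Nonempty with hY
    set Y' := D.filter fun B' => (B' ∩ B).card = 2 ∧ (B' ∩ insert q X).Nonempty with hY'
    have hYY' : Y ⊆ Y' := by
      intro P hP
      simp only [hY, hY', mem_filter] at hP ⊢
      exact ⟨hP.1, hP.2.1, hP.2.2.mono (inter_subset_inter_left (Finset.subset_insert q X))⟩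
    set bad : α → Finset (Finset α) := fun q' =>
      (B.powersetCard 2).filter fun e => ∃ B' ∈ D, e ⊆ B' ∧ q ∈ B' ∧ q' ∈ B' with hbad
    set good := B.powersetCard 2 \ X.biUnion bad with hgood
    have hbadc : (2 * (X.biUnion bad).card : ℕ) ≤ X.card * B.card := by
      have h1 : (X.biUnion bad).card ≤ ∑ q' ∈ X, (bad q').card := card_biUnion_le
      have h2 : ∑ q' ∈ X, 2 * (bad q').card ≤ ∑ q' ∈ X, B.card := by
        apply sum_le_sum
        intro q' hq'
        exact card_le_of_pencil hinter hB hqS.2 (Finset.mem_sdiff.1 (hX' hq')).2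
          (fun h => hqX (h ▸ hq'))
      rw [← mul_sum, sum_const, smul_eq_mul] at h2
      omega
    have hgoodc : (B.card.choose 2) ≤ good.card + (X.biUnion bad).card := by
      rw [← card_powersetCard]
      have := le_card_sdiff (X.biUnion bad) (B.powersetCard 2)
      rw [← hgood] at this
      omega
    have hnew : good.card ≤ (Y' \ Y).card := by
      apply card_le_card_of_forall_subsingleton (fun e P => e ⊆ P)
      · intro e he
        simp only [hgood, Finset.mem_sdiff, mem_powersetCard, Finset.mem_biUnion, not_exists, not_and] at he
        obtain ⟨⟨heB, hec⟩, hnb⟩ := he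
        have hqe : q ∉ e := fun h => hqS.2 (heB h)
        obtain ⟨P, hP, hTP⟩ := hcover (insert q e)
          (insert_subset hqS.1 (heB.trans hBS)) (by rw [card_insert_of_notMem hqe, hec])
        have hqP : q ∈ P := hTP (Finset.mem_insert_self q e)
        have heP : e ⊆ P := (Finset.subset_insert q e).trans hTP
        have hc : (P ∩ B).card = 2 := by
          have h1 := hinter P hP B hB (fun h => hqS.2 (h ▸ hqP))
          have h2 := Finset.card_le_card (subset_inter heP heB)
          omega
        refine ⟨P, ?_, heP⟩
        simp only [hY, hY', Finset.mem_sdiff, mem_filter, hP, hc, true_and]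
        refine ⟨⟨q, by simp [hqP]⟩, ?_⟩
        rintro ⟨q', hq'⟩
        rw [Finset.mem_inter] at hq'
        apply hnb q' hq'.2
        simp only [hbad, mem_filter, mem_powersetCard]
        exact ⟨⟨heB, hec⟩, P, hP, heP, hqP, hq'.1⟩
      · rintro P hP e ⟨he, heP⟩ f ⟨hf, hfP⟩
        simp only [hgood, Finset.mem_sdiff, mem_powersetCard, hY', mem_filter] at he hf hP
        have h1 : e = P ∩ B := eq_of_subset_of_card_le (subset_inter heP he.1.1) (by omega)
        have h2 : f = P ∩ B := eq_of_subset_of_card_le (subset_inter hfP hf.1.1) (by omega)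
        rw [h1, h2]
    have hcard : (Y' \ Y).card + Y.card = Y'.card := card_sdiff_add_card_eq_card hYY'
    rw [card_insert_of_notMem hqX]
    have r1 : (2 * (X.biUnion bad).card : ℝ) ≤ X.card * B.card := by exact_mod_cast hbadc
    have r2 : ((B.card.choose 2 : ℕ) : ℝ) ≤ good.card + (X.biUnion bad).card := by
      exact_mod_cast hgoodc
    have r3 : (good.card : ℝ) ≤ (Y' \ Y).card := by exact_mod_cast hnew
    have r4 : ((Y' \ Y).card : ℝ) + Y.card = Y'.card := by exact_mod_cast hcard
    rw [Nat.cast_choose_two] at r2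
    push_cast
    linarith

theorem card_blocks_ge_of_block {S : Finset α} {D : Finset (Finset α)}
    (hcover : ∀ T ⊆ S, T.card = 3 → ∃ B ∈ D, T ⊆ B)
    (hinter : ∀ B ∈ D, ∀ B' ∈ D, B ≠ B' → (B ∩ B').card ≤ 2)
    {B : Finset α} (hB : B ∈ D) (hBS : B ⊆ S) (h3 : 3 ≤ B.card) {x : ℕ}
    (hx : x + B.card ≤ S.card) :
    1 + (x : ℝ) * B.card * (2 * B.card - x - 1) / 4 ≤ (D.card : ℝ) := by
  obtain ⟨X, hX, rfl⟩ := exists_subset_card_eq (s := S \ B) (n := x)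
    (by rw [card_sdiff_of_subset hBS]; omega)
  have h1 := card_blocks_meeting_ge hcover hinter hB hBS X hX
  set Y := D.filter fun B' => (B' ∩ B).card = 2 ∧ (B' ∩ X).Nonempty with hY
  have h2 : Y ⊂ D := by
    refine (Finset.ssubset_iff_of_subset (filter_subset _ _)).2 ⟨B, hB, ?_⟩
    simp only [mem_filter, Finset.inter_self, not_and]
    intro _ h
    omega
  have h4 : (Y.card : ℝ) + 1 ≤ D.card := by exact_mod_cast Finset.card_lt_card h2
  linarith

theorem sum_card_large_blocks_le {S : Finset α} {G : Finset (Finset α)}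
    (hsub : ∀ B ∈ G, B ⊆ S)
    (hinter : ∀ B ∈ G, ∀ B' ∈ G, B ≠ B' → (B ∩ B').card ≤ 2) {s : ℕ}
    (hs : ∀ B ∈ G, s ≤ B.card) (hsn : 4 * S.card < s ^ 2) :
    ∑ B ∈ G, B.card ≤ 2 * S.card := by
  set I := ∑ B ∈ G, B.card with hI
  have hinc : ∀ B ∈ G, B.card = ∑ p ∈ S, if p ∈ B then 1 else 0 := by
    intro B hB
    rw [← card_filter, filter_mem_eq_inter, Finset.inter_eq_right.2 (hsub B hB)]
  set d : α → ℕ := fun p => ∑ B ∈ G, if p ∈ B then 1 else 0 with hd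
  have hId : I = ∑ p ∈ S, d p := by
    rw [hI, sum_congr rfl hinc, sum_comm]
  have hsq : ∑ p ∈ S, d p ^ 2 = ∑ B ∈ G, ∑ B' ∈ G, (B ∩ B').card := by
    have : ∀ B ∈ G, ∀ B' ∈ G, (B ∩ B').card =
        ∑ p ∈ S, (if p ∈ B then 1 else 0) * (if p ∈ B' then 1 else 0) := by
      intro B hB B' hB'
      have h : ∀ p ∈ S, (if p ∈ B then 1 else 0) * (if p ∈ B' then 1 else 0) =
          if p ∈ B ∩ B' then 1 else 0 := by
        intro p _
        by_cases h1 : p ∈ B <;> by_cases h2 : p ∈ B' <;> simp [h1, h2]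
      rw [sum_congr rfl h, ← card_filter, filter_mem_eq_inter,
        Finset.inter_eq_right.2 (inter_subset_left.trans (hsub B hB))]
    rw [sum_congr rfl fun B hB => sum_congr rfl (this B hB)]
    simp only [hd, sq, sum_mul_sum]
    rw [sum_comm]
    apply sum_congr rfl
    intro B _
    rw [sum_comm]
  have hup : ∑ B ∈ G, ∑ B' ∈ G, (B ∩ B').card ≤ I + 2 * G.card ^ 2 := by
    have : ∀ B ∈ G, ∑ B' ∈ G, (B ∩ B').card ≤ B.card + G.card * 2 := by
      intro B hB
      calc ∑ B' ∈ G, (B ∩ B').card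
          ≤ ∑ B' ∈ G, ((if B = B' then B.card else 0) + 2) := by
            apply sum_le_sum
            intro B' hB'
            split_ifs with h
            · subst h; simp
            · have := hinter B hB B' hB' h; omega
        _ = B.card + G.card * 2 := by
            rw [sum_add_distrib, sum_ite_eq, if_pos hB, sum_const, smul_eq_mul]
    calc _ ≤ ∑ B ∈ G, (B.card + G.card * 2) := sum_le_sum this
      _ = _ := by rw [sum_add_distrib, sum_const, smul_eq_mul]; ring
  have hcs : (∑ p ∈ S, d p) ^ 2 ≤ S.card * ∑ p ∈ S, d p ^ 2 := sq_sum_le_card_mul_sum_sq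
  have hsI : s * G.card ≤ I := by
    have := card_nsmul_le_sum G (fun B => B.card) s hs
    rw [smul_eq_mul] at this
    linarith
  rw [← hId, hsq] at hcs
  by_contra! hlt
  have e1 : I ^ 2 ≤ S.card * (I + 2 * G.card ^ 2) := hcs.trans (Nat.mul_le_mul_left _ hup)
  have e2 : (s * G.card) ^ 2 ≤ I ^ 2 := Nat.pow_le_pow_left hsI 2
  have e3 : I ^ 2 * s ^ 2 ≤ S.card * I * s ^ 2 + 2 * S.card * I ^ 2 := by nlinarith
  have hI0 : 0 < I := by omega
  have e4 : I * s ^ 2 ≤ S.card * s ^ 2 + 2 * S.card * I := by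
    apply Nat.le_of_mul_le_mul_left _ hI0
    nlinarith
  nlinarith

theorem card_triples_le {S : Finset α} {D : Finset (Finset α)}
    (hcover : ∀ T ⊆ S, T.card = 3 → ∃ B ∈ D, T ⊆ B) :
    S.card.choose 3 ≤ ∑ B ∈ D, B.card.choose 3 := by
  have h : S.powersetCard 3 ⊆ D.biUnion fun B => B.powersetCard 3 := by
    intro T hT
    rw [mem_powersetCard] at hT
    obtain ⟨B, hB, hTB⟩ := hcover T hT.1 hT.2
    exact Finset.mem_biUnion.2 ⟨B, hB, mem_powersetCard.2 ⟨hTB, hT.2⟩⟩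
  have h1 := (Finset.card_le_card h).trans card_biUnion_le
  simpa [card_powersetCard] using h1

theorem sum_card_mul_le {S : Finset α} {D : Finset (Finset α)} (hsub : ∀ B ∈ D, B ⊆ S)
    (hmel : ∀ p ∈ S, ∑ B ∈ D with p ∈ B, ((B.card : ℝ) - 4) ≤ S.card - 1) :
    ∑ B ∈ D, (B.card : ℝ) * (B.card - 4) ≤ S.card * (S.card - 1) := by
  have h := sum_le_sum hmel
  rw [sum_const, nsmul_eq_mul] at h
  refine le_trans (le_of_eq ?_) h
  simp only [sum_filter]
  rw [sum_comm]
  apply sum_congr rfl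
  intro B hB
  rw [← sum_filter, filter_mem_eq_inter, Finset.inter_eq_right.2 (hsub B hB), sum_const, nsmul_eq_mul]

theorem cast_choose_three (i : ℕ) :
    ((i.choose 3 : ℕ) : ℝ) = i * (i - 1) * (i - 2) / 6 := by
  rw [Nat.cast_choose_eq_descPochhammer_div]
  simp [descPochhammer_succ_right, Nat.factorial]

theorem card_blocks_ge_of_small {S : Finset α} {D : Finset (Finset α)}
    (hsub : ∀ B ∈ D, B ⊆ S) (h3 : ∀ B ∈ D, 3 ≤ B.card)
    (hcover : ∀ T ⊆ S, T.card = 3 → ∃ B ∈ D, T ⊆ B)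
    (hinter : ∀ B ∈ D, ∀ B' ∈ D, B ≠ B' → (B ∩ B').card ≤ 2)
    (hmel : ∀ p ∈ S, ∑ B ∈ D with p ∈ B, ((B.card : ℝ) - 4) ≤ S.card - 1)
    (hsmall : ∀ B ∈ D, (B.card : ℝ) ≤ S.card / 3) (hS : 59 ≤ S.card)
    {u : ℕ} (hu' : 4 * S.card < (u + 1) ^ 2) :
    (S.card : ℝ) * (7 / 9 * S.card ^ 2 - S.card - 2 - (u + 5 / 4) * (S.card - 1)) ≤
      (3 * u + 39 / 4) * D.card := by
  set n := S.card with hn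
  have hu15 : 15 ≤ u := by nlinarith
  have hu15' : (15 : ℝ) ≤ u := by exact_mod_cast hu15
  have hn' : (59 : ℝ) ≤ n := by exact_mod_cast hS
  set β : ℝ := u + 5 / 4 with hβ
  set W : ℝ := (n / 3 - 1) * (n / 3 - 2) with hW
  have hW0 : 0 ≤ W := by rw [hW]; apply mul_nonneg <;> linarith
  have hterm : ∀ B ∈ D, (B.card : ℝ) * (B.card - 1) * (B.card - 2) ≤
      (3 * β + 6) + β * (B.card * (B.card - 4)) + if u + 1 ≤ B.card then B.card * W else 0 := by
    intro B hB
    have hi3 : (3 : ℝ) ≤ B.card := by exact_mod_cast h3 B hB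
    have hiM := hsmall B hB
    split_ifs with h
    · have hi : (u : ℝ) + 1 ≤ B.card := by exact_mod_cast h
      have t1 : ((B.card : ℝ) - 1) * (B.card - 2) ≤ W := by
        rw [hW]; apply mul_le_mul <;> linarith
      have t2 : 0 ≤ β * ((B.card : ℝ) * (B.card - 4)) := by
        apply mul_nonneg (by linarith); apply mul_nonneg <;> linarith
      have t3 := mul_le_mul_of_nonneg_left t1 (by linarith : (0 : ℝ) ≤ B.card)
      linarith
    · have hi : (B.card : ℝ) ≤ u := by exact_mod_cast (by omega : B.card ≤ u)
      have t1 : (B.card : ℝ) ^ 2 + 2 - β * (B.card - 1) ≤ 0 := by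
        rw [hβ]; nlinarith [mul_nonneg (sub_nonneg.2 hi3) (sub_nonneg.2 hi)]
      have t2 := mul_nonneg (sub_nonneg.2 hi3) (neg_nonneg.2 t1)
      nlinarith
  have htri : (n : ℝ) * (n - 1) * (n - 2) ≤
      ∑ B ∈ D, (B.card : ℝ) * (B.card - 1) * (B.card - 2) := by
    have h : ((n.choose 3 : ℕ) : ℝ) ≤ ∑ B ∈ D, ((B.card.choose 3 : ℕ) : ℝ) := by
      exact_mod_cast card_triples_le hcover
    simp only [cast_choose_three, ← sum_div] at h
    linarith
  have hlarge : ∑ B ∈ D, (if u + 1 ≤ B.card then B.card * W else 0) ≤ 2 * n * W := by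
    rw [← sum_filter, ← sum_mul]
    apply mul_le_mul_of_nonneg_right _ hW0
    have := sum_card_large_blocks_le (S := S) (G := D.filter fun B => u + 1 ≤ B.card) (s := u + 1)
      (fun B hB => hsub B (mem_filter.1 hB).1)
      (fun B hB B' hB' => hinter B (mem_filter.1 hB).1 B' (mem_filter.1 hB').1)
      (fun B hB => (mem_filter.1 hB).2) hu'
    exact_mod_cast this
  have hsum := sum_le_sum hterm
  rw [sum_add_distrib, sum_add_distrib, sum_const, nsmul_eq_mul, ← mul_sum] at hsum
  have hm := mul_le_mul_of_nonneg_left (sum_card_mul_le hsub hmel) (by linarith : 0 ≤ β)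
  have : (n : ℝ) * (7 / 9 * n ^ 2 - n - 2 - β * (n - 1)) =
      n * (n - 1) * (n - 2) - β * (n * (n - 1)) - 2 * n * W := by rw [hW]; ring
  have : (3 * u + 39 / 4) * (D.card : ℝ) = D.card * (3 * β + 6) := by rw [hβ]; ring
  linarith

theorem sqrt_mul_add_le {n k u : ℝ} (hk : k = 1 ∨ 2 ≤ k) (hbig : n ≥ 54 * k ^ 2 + (9 / 2) * k)
    (hu0 : 0 ≤ u) (hu : u ^ 2 ≤ 4 * n) :
    (3 * u + 39 / 4) * k / 2 ≤ 7 / 9 * n - u - 9 / 4 := by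
  have hk0 : 0 ≤ k := by rcases hk with rfl | h <;> linarith
  set z := √n with hz
  have hzn : z ^ 2 = n := Real.sq_sqrt (by nlinarith)
  have hz0 : 0 ≤ z := Real.sqrt_nonneg _
  have huz : u ≤ 2 * z := by
    refine (sq_le_sq₀ hu0 (by linarith)).1 ?_
    linarith
  rcases hk with rfl | hk2
  · have : 15 / 2 ≤ z := by nlinarith
    nlinarith
  · have hz15 : 15 ≤ z := by nlinarith
    have hkz : k ≤ 3 / 22 * z := by
      refine (sq_le_sq₀ hk0 (by linarith)).1 ?_
      nlinarith
    have : (3 * u + 39 / 4) * k ≤ (3 * (2 * z) + 39 / 4) * (3 / 22 * z) := by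
      apply mul_le_mul <;> linarith
    nlinarith

theorem cubic_monotone_aux {n k x : ℝ} (hk : 0 ≤ k) (hkx : k ≤ x) (hn : 58 ≤ n)
    (hnk : 58 * k ≤ n) (hxn : 2 * x ≤ n) :
    k * (n - k) * (2 * n - 3 * k - 1) ≤ x * (n - x) * (2 * n - 3 * x - 1) := by
  have hq : 0 ≤ (2 * n ^ 2 - n) - (5 * n - 1) * (x + k) + 3 * (x ^ 2 + x * k + k ^ 2) := by
    have : 0 ≤ (n - 2 * x) * (7 * n - 6 * x) := by apply mul_nonneg <;> linarith
    have : 0 ≤ (n - 58 * k) * n := by apply mul_nonneg <;> linarith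
    have : 58 * n ≤ n * n := by nlinarith
    nlinarith [mul_nonneg (hk.trans hkx) hk]
  nlinarith [mul_nonneg (sub_nonneg.2 hkx) hq]

theorem card_blocks_ge_of_large {S : Finset α} {D : Finset (Finset α)}
    (hcover : ∀ T ⊆ S, T.card = 3 → ∃ B ∈ D, T ⊆ B)
    (hinter : ∀ B ∈ D, ∀ B' ∈ D, B ≠ B' → (B ∩ B').card ≤ 2)
    {k : ℕ} (hk : 1 ≤ k) (hbig : (S.card : ℝ) ≥ 54 * k ^ 2 + (9 / 2) * k)
    {B : Finset α} (hB : B ∈ D) (hBS : B ⊆ S) (h3 : 3 ≤ B.card) (hcap : B.card + k ≤ S.card)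
    (hBn : (S.card : ℝ) / 3 < B.card) :
    1 + (k : ℝ) * (S.card - k) * (2 * S.card - 3 * k - 1) / 4 ≤ D.card := by
  set n := S.card with hn
  have hk' : (1 : ℝ) ≤ k := by exact_mod_cast hk
  have hnk : 58 * (k : ℝ) ≤ n := by nlinarith
  have hcapB : (B.card : ℝ) + k ≤ n := by exact_mod_cast hcap
  set M := B.card with hM
  by_cases hhalf : 2 * M < n
  · have h := card_blocks_ge_of_block hcover hinter hB hBS h3 (x := M) (by omega)
    rw [← hM] at h
    refine le_trans ?_ h
    have t1 : 18 * (k : ℝ) ≤ M - 1 := by nlinarith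
    have t2 : (n : ℝ) ^ 2 / 9 ≤ M * M := by nlinarith
    have t3 : (n : ℝ) ^ 2 / 9 * (18 * k) ≤ M * M * (M - 1) := by
      apply mul_le_mul t2 t1 <;> nlinarith
    have t4 : ((n : ℝ) - k) * (2 * n - 3 * k - 1) ≤ n * (2 * n) := by
      apply mul_le_mul <;> linarith
    have t5 := mul_le_mul_of_nonneg_left t4 (by linarith : (0 : ℝ) ≤ k)
    linarith
  · obtain ⟨x, hx⟩ : ∃ x, n = M + x := ⟨n - M, by omega⟩
    have h := card_blocks_ge_of_block hcover hinter hB hBS h3 (x := x) (by omega)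
    rw [← hM] at h
    refine le_trans ?_ h
    have hx' : (n : ℝ) = M + x := by exact_mod_cast hx
    have hxn : 2 * (x : ℝ) ≤ n := by
      have : (n : ℝ) ≤ 2 * M := by exact_mod_cast not_lt.1 hhalf
      linarith
    have := cubic_monotone_aux (by linarith) (by linarith : (k : ℝ) ≤ x) (by linarith) hnk hxn
    have hMe : (M : ℝ) = n - x := by linarith
    rw [hMe]
    linarith

theorem card_blocks_ge {S : Finset α} {D : Finset (Finset α)}
    (hsub : ∀ B ∈ D, B ⊆ S) (h3 : ∀ B ∈ D, 3 ≤ B.card)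
    (hcover : ∀ T ⊆ S, T.card = 3 → ∃ B ∈ D, T ⊆ B)
    (hinter : ∀ B ∈ D, ∀ B' ∈ D, B ≠ B' → (B ∩ B').card ≤ 2)
    (hmel : ∀ p ∈ S, ∑ B ∈ D with p ∈ B, ((B.card : ℝ) - 4) ≤ S.card - 1)
    {k : ℕ} (hk : 1 ≤ k) (hbig : (S.card : ℝ) ≥ 54 * k ^ 2 + (9 / 2) * k)
    (hcap : ∀ B ∈ D, B.card + k ≤ S.card) :
    1 + (k : ℝ) * (S.card - k) * (2 * S.card - 3 * k - 1) / 4 ≤ D.card := by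
  by_cases hlarge : ∃ B ∈ D, (S.card : ℝ) / 3 < B.card
  · obtain ⟨B, hB, hBn⟩ := hlarge
    exact card_blocks_ge_of_large hcover hinter hk hbig hB (hsub B hB) (h3 B hB) (hcap B hB) hBn
  push Not at hlarge
  set n := S.card with hn
  have hk' : (1 : ℝ) ≤ k := by exact_mod_cast hk
  have hnk : 58 * (k : ℝ) ≤ n := by nlinarith
  have hn58 : (58 : ℝ) < n := by nlinarith
  have hn59 : 59 ≤ n := by exact_mod_cast hn58
  have hu := Nat.sqrt_le' (4 * n)
  have hu' := Nat.lt_succ_sqrt' (4 * n)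
  have hu2 : 2 ≤ Nat.sqrt (4 * n) := Nat.le_sqrt'.2 (by omega)
  set u := Nat.sqrt (4 * n)
  have h := card_blocks_ge_of_small hsub h3 hcover hinter hmel hlarge hn59 hu'
  rw [← hn] at h
  have hu2' : (2 : ℝ) ≤ u := by exact_mod_cast hu2
  have harith := sqrt_mul_add_le (n := n) (k := k) (u := u)
    (hk.eq_or_lt.imp (fun h => by rw [← h, Nat.cast_one]) fun h => by exact_mod_cast h)
    hbig (by linarith) (by exact_mod_cast hu)
  have e1 : 1 + (k : ℝ) * (n - k) * (2 * n - 3 * k - 1) / 4 ≤ k * n ^ 2 / 2 := by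
    have t1 : (k : ℝ) * (3 * k + 1) ≤ n * (3 * k + 1) :=
      mul_le_mul_of_nonneg_right (by linarith) (by linarith)
    have t2 : (1 : ℝ) * 58 ≤ k * n := mul_le_mul hk' hn58.le (by norm_num) (by linarith)
    have t3 : (1 : ℝ) * 58 ≤ k * (k * n) := mul_le_mul hk' (by linarith) (by norm_num) (by linarith)
    have t4 := mul_le_mul_of_nonneg_left t1 (by linarith : (0 : ℝ) ≤ k)
    linarith
  have e2 : (3 * (u : ℝ) + 39 / 4) * (k * n ^ 2 / 2) ≤
      n * (7 / 9 * n ^ 2 - n - 2 - (u + 5 / 4) * (n - 1)) := by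
    have t1 := mul_le_mul_of_nonneg_left harith (sq_nonneg (n : ℝ))
    have t2 : (0 : ℝ) ≤ n * (u - 3 / 4) := mul_nonneg (by linarith) (by linarith)
    linarith
  have e3 := le_of_mul_le_mul_left (e2.trans h) (by linarith)
  linarith

end Blocks

theorem range_vecTriple {β : Type*} (a b c : β) : Set.range ![a, b, c] = {a, b, c} := by
  ext z
  simp [eq_comm]
  tauto

theorem exists_generic_duals {ι : Type*} [Finite ι] (v : ι → Pt3)
    (hv : Pairwise fun i j => LinearIndependent ℝ ![v i, v j]) (hv0 : ∀ i, v i ≠ 0) :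
    ∃ f g h : Module.Dual ℝ Pt3, (∀ i, g (v i) ≠ 0) ∧
      (∀ i j, i ≠ j → f (v i) * g (v j) - f (v j) * g (v i) ≠ 0) ∧
      ∀ x y : ℝ, x • f + y • g + h ≠ 0 := by
  obtain ⟨g, hg⟩ := Module.exists_dual_forall_apply_ne_zero (K := ℝ) v hv0
  obtain ⟨f, hf⟩ := Module.exists_dual_forall_apply_ne_zero (K := ℝ)
    (fun ij : {ij : ι × ι // ij.1 ≠ ij.2} => g (v ij.1.2) • v ij.1.1 - g (v ij.1.1) • v ij.1.2)
    (by
      rintro ⟨⟨i, j⟩, hij⟩ h0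
      have := LinearIndependent.pair_iff.1 (hv hij) (g (v j)) (-g (v i))
        (by simpa [sub_eq_add_neg] using h0)
      exact hg j this.1)
  obtain ⟨h, hh⟩ : ∃ h : Module.Dual ℝ Pt3, h ∉ Submodule.span ℝ {f, g} := by
    by_contra! hall
    have htop : Submodule.span ℝ {f, g} = ⊤ := by
      rw [eq_top_iff]; exact fun h _ => hall h
    have h1 := finrank_range_le_card (R := ℝ) ![f, g]
    have h2 : Set.range ![f, g] = {f, g} := by
      ext z
      simp [eq_comm, or_comm]
    rw [Set.finrank, h2, htop, finrank_top, Subspace.dual_finrank_eq,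
      finrank_euclideanSpace_fin, Fintype.card_fin] at h1
    omega
  refine ⟨f, g, h, hg, fun i j hij => ?_, fun x y h0 => hh ?_⟩
  · have := hf ⟨(i, j), hij⟩
    simp only [map_sub, map_smul, smul_eq_mul] at this
    intro h0
    apply this
    linarith
  · rw [Submodule.mem_span_pair]
    refine ⟨-x, -y, ?_⟩
    rw [neg_smul, neg_smul, ← sub_eq_zero, ← neg_eq_zero, ← h0]
    abel

theorem IsPlane.eq_affineSpan {P : Set Pt3} (hP : IsPlane P) {p q r : Pt3} (hp : p ∈ P)
    (hq : q ∈ P) (hr : r ∈ P) (h : AffineIndependent ℝ ![p, q, r]) :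
    P = (affineSpan ℝ ({p, q, r} : Set Pt3) : Set Pt3) := by
  obtain ⟨a, b, c, habc, rfl⟩ := hP
  have hfr : Module.finrank ℝ (affineSpan ℝ ({a, b, c} : Set Pt3)).direction = 2 := by
    rw [direction_affineSpan, ← range_vecTriple]
    exact habc.finrank_vectorSpan (by simp)
  have := h.affineSpan_eq_of_le_of_card_eq_finrank_add_one
    (sp := affineSpan ℝ ({a, b, c} : Set Pt3))
    (by
      rw [range_vecTriple, affineSpan_le]
      rintro z (rfl | rfl | rfl) <;> assumption)
    (by rw [hfr]; simp)
  rw [← this, range_vecTriple]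

theorem affineSpan_triple_eq_of_dual {p q r : Pt3} (h : AffineIndependent ℝ ![p, q, r])
    {f : Module.Dual ℝ Pt3} (hf : f ≠ 0) (hq : f (q - p) = 0) (hr : f (r - p) = 0) (z : Pt3) :
    z ∈ affineSpan ℝ ({p, q, r} : Set Pt3) ↔ f (z - p) = 0 := by
  have hfr := Module.Dual.finrank_ker_add_one_of_ne_zero hf
  rw [finrank_euclideanSpace_fin] at hfr
  have := h.affineSpan_eq_of_le_of_card_eq_finrank_add_one
    (sp := AffineSubspace.mk' p (LinearMap.ker f))
    (by
      rw [range_vecTriple, affineSpan_le]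
      rintro z (rfl | rfl | rfl)
      · simp
      · simpa [AffineSubspace.mem_mk'] using hq
      · simpa [AffineSubspace.mem_mk'] using hr)
    (by rw [AffineSubspace.direction_mk']; simp; omega)
  rw [← range_vecTriple, this]
  simp [AffineSubspace.mem_mk']

theorem NoThreeCollinear.affineIndependent {S : Set Pt3} (h3 : NoThreeCollinear S) {p q r : Pt3}
    (hp : p ∈ S) (hq : q ∈ S) (hr : r ∈ S) (hpq : p ≠ q) (hpr : p ≠ r) (hqr : q ≠ r) :
    AffineIndependent ℝ ![p, q, r] := by
  rw [affineIndependent_iff_not_collinear_set]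
  apply h3
  · rintro z (rfl | rfl | rfl) <;> assumption
  · exact Set.ncard_eq_three.2 ⟨p, q, r, hpq, hpr, hqr, rfl⟩

theorem isPlane_affineSpan {p q r : Pt3} (h : AffineIndependent ℝ ![p, q, r]) :
    IsPlane (affineSpan ℝ ({p, q, r} : Set Pt3) : Set Pt3) :=
  ⟨p, q, r, h, rfl⟩

theorem linearIndependent_sub_pair {p q r : Pt3} (h : AffineIndependent ℝ ![p, q, r]) :
    LinearIndependent ℝ ![q - p, r - p] := by
  have h1 := (affineIndependent_iff_linearIndependent_vsub ℝ _ (0 : Fin 3)).1 h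
  have h2 := h1.comp (![⟨1, by decide⟩, ⟨2, by decide⟩] : Fin 2 → {x : Fin 3 // x ≠ 0})
    (by intro i j; fin_cases i <;> fin_cases j <;> simp)
  have he : ![q - p, r - p] = (fun i : {x : Fin 3 // x ≠ 0} => ![p, q, r] i -ᵥ ![p, q, r] 0) ∘
      ![⟨1, by decide⟩, ⟨2, by decide⟩] := by
    ext i : 1
    fin_cases i <;> simp
  rw [he]
  exact h2

/-- The intersections of `S` with the planes it determines. -/
def planeBlocks (S : Finset Pt3) : Finset (Finset Pt3) :=
  open Classical in
  S.powerset.filter fun B => 3 ≤ B.card ∧ ∃ P, IsPlane P ∧ (B : Set Pt3) = ↑S ∩ P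

theorem mem_planeBlocks {S B : Finset Pt3} : B ∈ planeBlocks S ↔
    B ⊆ S ∧ 3 ≤ B.card ∧ ∃ P, IsPlane P ∧ (B : Set Pt3) = ↑S ∩ P := by
  simp [planeBlocks]

theorem exists_block_of_affineIndependent {S : Finset Pt3} {p q r : Pt3}
    (hp : p ∈ S) (hq : q ∈ S) (hr : r ∈ S) (h : AffineIndependent ℝ ![p, q, r]) :
    ∃ B ∈ planeBlocks S, p ∈ B ∧ q ∈ B ∧ r ∈ B := by
  classical
  have hmem : ∀ z ∈ ({p, q, r} : Set Pt3), z ∈ affineSpan ℝ ({p, q, r} : Set Pt3) :=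
    fun z hz => subset_affineSpan ℝ _ hz
  refine ⟨S.filter (· ∈ affineSpan ℝ ({p, q, r} : Set Pt3)), mem_planeBlocks.2
    ⟨Finset.filter_subset _ _, ?_, _, isPlane_affineSpan h, by ext z; simp⟩, ?_, ?_, ?_⟩
  · have hsub : ({p, q, r} : Finset Pt3) ⊆
        S.filter (· ∈ affineSpan ℝ ({p, q, r} : Set Pt3)) := by
      intro z hz
      rw [Finset.mem_filter]
      simp only [Finset.mem_insert, Finset.mem_singleton] at hz
      refine ⟨?_, hmem z hz⟩
      rcases hz with rfl | rfl | rfl <;> assumption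
    have hc : ({p, q, r} : Finset Pt3).card = 3 := by
      have inj := h.injective
      rw [Finset.card_eq_three]
      exact ⟨p, q, r, fun e => by simpa using @inj 0 1 e, fun e => by simpa using @inj 0 2 e,
        fun e => by simpa using @inj 1 2 e, rfl⟩
    exact hc.symm.le.trans (Finset.card_le_card hsub)
  · exact Finset.mem_filter.2 ⟨hp, hmem p (by simp)⟩
  · exact Finset.mem_filter.2 ⟨hq, hmem q (by simp)⟩
  · exact Finset.mem_filter.2 ⟨hr, hmem r (by simp)⟩

theorem planeBlocks_cover {S : Finset Pt3} (h3 : NoThreeCollinear (S : Set Pt3)) :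
    ∀ T ⊆ S, T.card = 3 → ∃ B ∈ planeBlocks S, T ⊆ B := by
  classical
  intro T hT hc
  obtain ⟨p, q, r, hpq, hpr, hqr, rfl⟩ := Finset.card_eq_three.1 hc
  have hp : p ∈ S := hT (by simp)
  have hq : q ∈ S := hT (by simp)
  have hr : r ∈ S := hT (by simp)
  obtain ⟨B, hB, h⟩ := exists_block_of_affineIndependent hp hq hr
    (h3.affineIndependent hp hq hr hpq hpr hqr)
  refine ⟨B, hB, ?_⟩
  intro z hz
  simp only [Finset.mem_insert, Finset.mem_singleton] at hz
  rcases hz with rfl | rfl | rfl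
  exacts [h.1, h.2.1, h.2.2]

theorem IsPlane.eq_of_three_le_card {S B : Finset Pt3} (h3 : NoThreeCollinear (S : Set Pt3))
    (hBS : B ⊆ S) (hB : 3 ≤ B.card) {P Q : Set Pt3} (hP : IsPlane P) (hQ : IsPlane Q)
    (hBP : (B : Set Pt3) ⊆ P) (hBQ : (B : Set Pt3) ⊆ Q) : P = Q := by
  obtain ⟨p, hp, q, hq, r, hr, hpq, hpr, hqr⟩ := Finset.two_lt_card.1 hB
  have h := h3.affineIndependent (hBS hp) (hBS hq) (hBS hr) hpq hpr hqr
  rw [hP.eq_affineSpan (hBP hp) (hBP hq) (hBP hr) h, hQ.eq_affineSpan (hBQ hp) (hBQ hq) (hBQ hr) h]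

theorem planeBlocks_inter [DecidableEq Pt3] {S : Finset Pt3}
    (h3 : NoThreeCollinear (S : Set Pt3)) :
    ∀ B ∈ planeBlocks S, ∀ B' ∈ planeBlocks S, B ≠ B' → (B ∩ B').card ≤ 2 := by
  intro B hB B' hB' hne
  by_contra! hc
  obtain ⟨hBS, -, P, hP, hBP⟩ := mem_planeBlocks.1 hB
  obtain ⟨hBS', -, P', hP', hBP'⟩ := mem_planeBlocks.1 hB'
  have hPP : P = P' := by
    refine IsPlane.eq_of_three_le_card h3 (Finset.inter_subset_left.trans hBS) hc hP hP' ?_ ?_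
    · rw [Finset.coe_inter, hBP]
      exact fun z hz => hz.1.2
    · rw [Finset.coe_inter, hBP']
      exact fun z hz => hz.2.2
  exact hne (Finset.coe_injective (by rw [hBP, hBP', hPP]))

theorem card_planeBlocks {S : Finset Pt3} (h3 : NoThreeCollinear (S : Set Pt3)) :
    (detPlanes (S : Set Pt3)).ncard = (planeBlocks S).card := by
  classical
  rw [← Set.ncard_coe_finset]
  refine Set.ncard_congr (fun P _ => S.filter (· ∈ P)) ?_ ?_ ?_
  · rintro P ⟨hP, hc⟩
    refine mem_planeBlocks.2 ⟨Finset.filter_subset _ _, ?_, P, hP, by ext z; simp⟩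
    rw [← Set.ncard_coe_finset]
    convert hc using 2
    ext z; simp
  · rintro P Q ⟨hP, hPc⟩ ⟨hQ, hQc⟩ hPQ
    have hc : 3 ≤ (S.filter (· ∈ P)).card := by
      rw [← Set.ncard_coe_finset]
      convert hPc using 2
      ext z; simp
    refine IsPlane.eq_of_three_le_card h3 (Finset.filter_subset _ _) hc hP hQ ?_ ?_
    · intro z hz; exact (Finset.mem_filter.1 hz).2
    · intro z hz; rw [hPQ] at hz; exact (Finset.mem_filter.1 hz).2
  · intro B hB
    obtain ⟨hBS, hc, P, hP, hBP⟩ := mem_planeBlocks.1 hB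
    refine ⟨P, ⟨hP, ?_⟩, ?_⟩
    · rw [← hBP, Set.ncard_coe_finset]; exact hc
    · apply Finset.coe_injective
      rw [hBP]; ext z; simp

theorem sum_planeBlocks_through_le [DecidableEq Pt3] {S : Finset Pt3}
    (h3 : NoThreeCollinear (S : Set Pt3)) :
    ∀ p ∈ S, ∑ B ∈ planeBlocks S with p ∈ B, ((B.card : ℝ) - 4) ≤ S.card - 1 := by
  intro p hp
  set D := (planeBlocks S).filter (p ∈ ·) with hDdef
  set L := S.erase p with hL
  have hLS : ∀ q ∈ L, q ∈ S ∧ p ≠ q := fun q hq =>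
    ⟨Finset.mem_of_mem_erase hq, (Finset.ne_of_mem_erase hq).symm⟩
  obtain ⟨f, g, h, hg, hfg, hne⟩ := exists_generic_duals (fun q : L => (q : Pt3) - p)
    (by
      rintro ⟨q, hq⟩ ⟨r, hr⟩ hqr
      exact linearIndependent_sub_pair (h3.affineIndependent hp (hLS q hq).1 (hLS r hr).1
        (hLS q hq).2 (hLS r hr).2 fun e => hqr (Subtype.ext e)))
    (by
      rintro ⟨q, hq⟩
      exact sub_ne_zero.2 (hLS q hq).2.symm)
  replace hg : ∀ q ∈ L, g (q - p) ≠ 0 := fun q hq => hg ⟨q, hq⟩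
  replace hfg : ∀ q ∈ L, ∀ r ∈ L, q ≠ r →
      f (q - p) * g (r - p) - f (r - p) * g (q - p) ≠ 0 := fun q hq r hr hqr =>
    hfg ⟨q, hq⟩ ⟨r, hr⟩ fun e => hqr (congrArg Subtype.val e)
  have hcoord : ∀ B ∈ D, ∃ x y : ℝ, ∀ z ∈ S,
      z ∈ B ↔ x * f (z - p) + y * g (z - p) + h (z - p) = 0 := by
    intro B hB
    obtain ⟨hB, hpB⟩ := Finset.mem_filter.1 hB
    obtain ⟨hBS, hBc, P, hP, hBP⟩ := mem_planeBlocks.1 hB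
    have hBP' : ∀ z ∈ S, z ∈ B ↔ z ∈ P := by
      intro z hz
      rw [← Finset.mem_coe, hBP]
      simp [hz]
    obtain ⟨q, hq, r, hr, hqr⟩ := Finset.one_lt_card.1
      (by rw [Finset.card_erase_of_mem hpB]; omega : 1 < (B.erase p).card)
    rw [Finset.mem_erase] at hq hr
    have hqS := hBS hq.2
    have hrS := hBS hr.2
    have hind := h3.affineIndependent hp hqS hrS hq.1.symm hr.1.symm hqr
    have hPspan := hP.eq_affineSpan ((hBP' p hp).1 hpB) ((hBP' q hqS).1 hq.2)
      ((hBP' r hrS).1 hr.2) hind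
    have hdet := hfg q (Finset.mem_erase.2 ⟨hq.1, hqS⟩) r (Finset.mem_erase.2 ⟨hr.1, hrS⟩) hqr
    set d := f (q - p) * g (r - p) - f (r - p) * g (q - p) with hd
    refine ⟨(h (r - p) * g (q - p) - h (q - p) * g (r - p)) / d,
      (h (q - p) * f (r - p) - h (r - p) * f (q - p)) / d, fun z hz => ?_⟩
    rw [hBP' z hz, hPspan, SetLike.mem_coe, affineSpan_triple_eq_of_dual hind
      (hne ((h (r - p) * g (q - p) - h (q - p) * g (r - p)) / d)
        ((h (q - p) * f (r - p) - h (r - p) * f (q - p)) / d))]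
    · simp only [LinearMap.add_apply, LinearMap.smul_apply, smul_eq_mul]
    · simp only [LinearMap.add_apply, LinearMap.smul_apply, smul_eq_mul]
      field_simp
      rw [hd]; ring
    · simp only [LinearMap.add_apply, LinearMap.smul_apply, smul_eq_mul]
      field_simp
      rw [hd]; ring
  choose! x y hxy using hcoord
  have hline : ∀ B ∈ D, ∀ q ∈ L,
      (y B = -(f (q - p) / g (q - p)) * x B + -(h (q - p) / g (q - p)) ↔ q ∈ B) := by
    intro B hB q hq
    have := hg q hq
    rw [hxy B hB q (hLS q hq).1]
    constructor
    · intro e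
      rw [e]; field_simp; ring
    · intro e
      field_simp
      linarith
  have hsum := sum_card_incidence_le L D (fun q => -(f (q - p) / g (q - p)))
    (fun q => -(h (q - p) / g (q - p))) x y
    (by
      intro q hq r hr hqr
      by_contra hne
      apply hfg q hq r hr hne
      have h1 := hg q hq
      have h2 := hg r hr
      field_simp at hqr
      linarith)
    (by
      intro B hB B' hB' hx hy
      have hS : ∀ B ∈ D, B ⊆ S := fun B hB =>
        (mem_planeBlocks.1 (Finset.mem_filter.1 hB).1).1
      ext z
      constructor
      · intro hz
        have hzS := hS B hB hz
        rw [hxy B' hB' z hzS, ← hx, ← hy]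
        exact (hxy B hB z hzS).1 hz
      · intro hz
        have hzS := hS B' hB' hz
        rw [hxy B hB z hzS, hx, hy]
        exact (hxy B' hB' z hzS).1 hz)
    (by
      intro q hq r hr hqr
      obtain ⟨B, hB, hpB, hqB, hrB⟩ := exists_block_of_affineIndependent hp (hLS q hq).1
        (hLS r hr).1 (h3.affineIndependent hp (hLS q hq).1 (hLS r hr).1 (hLS q hq).2
          (hLS r hr).2 hqr)
      have hBD : B ∈ D := Finset.mem_filter.2 ⟨hB, hpB⟩
      exact ⟨B, hBD, (hline B hBD q hq).2 hqB, (hline B hBD r hr).2 hrB⟩)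
  have hcard : ∀ B ∈ D, ((L.filter fun q =>
      y B = -(f (q - p) / g (q - p)) * x B + -(h (q - p) / g (q - p))).card : ℝ) =
        B.card - 1 := by
    intro B hB
    have hpB := (Finset.mem_filter.1 hB).2
    have hBS := (mem_planeBlocks.1 (Finset.mem_filter.1 hB).1).1
    have : (L.filter fun q =>
        y B = -(f (q - p) / g (q - p)) * x B + -(h (q - p) / g (q - p))) = B.erase p := by
      rw [Finset.filter_congr (hline B hB), Finset.filter_mem_eq_inter, hL, Finset.erase_inter,
        Finset.inter_eq_right.2 hBS]
    rw [this, Finset.cast_card_erase_of_mem hpB]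
  have hsum' : ∑ B ∈ D, ((B.card : ℝ) - 1) ≤ 3 * D.card + L.card := by
    rw [← Finset.sum_congr rfl hcard]
    exact_mod_cast hsum
  rw [hL, Finset.cast_card_erase_of_mem hp] at hsum'
  simp only [Finset.sum_sub_distrib, Finset.sum_const, nsmul_eq_mul] at hsum' ⊢
  linarith

theorem stmt12 (S : Set Pt3) (hS : S.Finite) (n k : ℕ) (hn : S.ncard = n)
    (h3 : NoThreeCollinear S) (hk : 1 ≤ k)
    (hbig : (n : ℝ) ≥ 54 * k ^ 2 + (9 / 2) * k)
    (hcap : ∀ P : Set Pt3, IsPlane P → ((S ∩ P).ncard : ℤ) ≤ (n : ℤ) - k) :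
    ((detPlanes S).ncard : ℝ) ≥
      1 + (k : ℝ) * ((n - k).choose 2 : ℝ) - (k.choose 2 : ℝ) * ((n : ℝ) - k) / 2 := by
  classical
  lift S to Finset Pt3 using hS
  rw [Set.ncard_coe_finset] at hn
  subst hn
  have h := card_blocks_ge (fun B hB => (mem_planeBlocks.1 hB).1)
    (fun B hB => (mem_planeBlocks.1 hB).2.1) (planeBlocks_cover h3) (planeBlocks_inter h3)
    (sum_planeBlocks_through_le h3) hk hbig
    (by
      intro B hB
      obtain ⟨-, -, P, hP, hBP⟩ := mem_planeBlocks.1 hB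
      have := hcap P hP
      rw [← hBP, Set.ncard_coe_finset] at this
      omega)
  have hk' : (1 : ℝ) ≤ k := by exact_mod_cast hk
  have hkS : k ≤ S.card := by
    have : (k : ℝ) ≤ S.card := by nlinarith
    exact_mod_cast this
  rw [card_planeBlocks h3, Nat.cast_choose_two, Nat.cast_choose_two, Nat.cast_sub hkS]
  linarith
end
end

section
/- Let S be a set of n points in ℝ³, no three collinear, such that every plane contains at most n − k points of S, where k ≥ 1. If n ≥ (184 + 8/25)k² + 4k, then m₃ + m₄ ≥ k·C(n−k,2) − (n−k)·C(k,2). -/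
open Set

noncomputable section

theorem sum_card_le_of_slopes {ι κ : Type*} (X : Finset ι) (𝓛 : Finset κ) (f : κ → Finset ι)
    (m c : ι → ℝ) (s : κ → ℝ) (hm : Set.InjOn m X)
    (hsub : ∀ L ∈ 𝓛, f L ⊆ X)
    (hpair : ∀ a ∈ X, ∀ b ∈ X, a ≠ b → ∃ L ∈ 𝓛, a ∈ f L ∧ b ∈ f L)
    (hs : ∀ L ∈ 𝓛, ∀ a ∈ f L, ∀ b ∈ f L, c a - c b = s L * (m a - m b))
    (hinj : ∀ L ∈ 𝓛, ∀ L' ∈ 𝓛, ∀ a ∈ f L, a ∈ f L' → s L = s L' → L = L') :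
    ∑ L ∈ 𝓛, (f L).card ≤ 3 * 𝓛.card + X.card := by
  classical
  let I : Finset (Σ _ : κ, ι) := 𝓛.sigma f
  -- `R a L' L`: at `a`, the line `L'` is the one of next smaller slope than `L`
  let R : ι → κ → κ → Prop := fun a L' L =>
    L' ∈ 𝓛 ∧ a ∈ f L' ∧ s L' < s L ∧ ∀ K ∈ 𝓛, a ∈ f K → s K < s L → s K ≤ s L'
  have hRinj : ∀ a L' L₁ L₂, L₁ ∈ 𝓛 → L₂ ∈ 𝓛 → a ∈ f L₁ → a ∈ f L₂ →
      R a L' L₁ → R a L' L₂ → L₁ = L₂ := by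
    rintro a L' L₁ L₂ h₁ h₂ ha₁ ha₂ ⟨_, _, hl₁, hm₁⟩ ⟨_, _, hl₂, hm₂⟩
    apply hinj L₁ h₁ L₂ h₂ a ha₁ ha₂
    rcases lt_trichotomy (s L₁) (s L₂) with h | h | h
    · exact absurd (hm₂ L₁ h₁ ha₁ h) (not_le.2 hl₁)
    · exact h
    · exact absurd (hm₁ L₂ h₂ ha₂ h) (not_le.2 hl₂)
  have hRex : ∀ a L, (∃ K ∈ 𝓛, a ∈ f K ∧ s K < s L) → ∃ L', R a L' L := by
    rintro a L ⟨K, hK, haK, hlt⟩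
    obtain ⟨L', hL', hmax⟩ := (𝓛.filter fun K => a ∈ f K ∧ s K < s L).exists_max_image s
      ⟨K, by simp [hK, haK, hlt]⟩
    simp only [Finset.mem_filter] at hL' hmax
    exact ⟨L', hL'.1, hL'.2.1, hL'.2.2, fun K hK ha hl => hmax K ⟨hK, ha, hl⟩⟩
  let I₀ := I.filter fun z => ∀ b ∈ f z.1, m b ≤ m z.2
  let I₁ := I.filter fun z => ∀ K ∈ 𝓛, z.2 ∈ f K → s z.1 ≤ s K
  let I₂ := I.filter fun z => ∃ L', R z.2 L' z.1 ∧ ∀ b ∈ f L', m z.2 ≤ m b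
  let I₃ := I.filter fun z => ∃ L', ∃ b ∈ f z.1, m z.2 < m b ∧
    (∀ d ∈ f z.1, m z.2 < m d → m b ≤ m d) ∧ R b L' z.1 ∧ ∀ d ∈ f L', m d ≤ m b
  have hmemI : ∀ z, z ∈ I ↔ z.1 ∈ 𝓛 ∧ z.2 ∈ f z.1 := fun z => by simp [I]
  have c₀ : I₀.card ≤ 𝓛.card := by
    apply Finset.card_le_card_of_forall_subsingleton (fun z L => z.1 = L)
    · rintro z hz
      exact ⟨z.1, ((hmemI z).1 (Finset.mem_filter.1 hz).1).1, rfl⟩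
    · rintro L hL ⟨L₁, a₁⟩ ⟨h₁, e₁⟩ ⟨L₂, a₂⟩ ⟨h₂, e₂⟩
      simp only [I₀, Finset.mem_filter, hmemI] at h₁ h₂
      subst e₁; subst e₂
      have := hm (hsub _ hL h₁.1.2) (hsub _ hL h₂.1.2) (le_antisymm (h₂.2 _ h₁.1.2) (h₁.2 _ h₂.1.2))
      rw [this]
  have c₁ : I₁.card ≤ X.card := by
    apply Finset.card_le_card_of_forall_subsingleton (fun z a => z.2 = a)
    · rintro z hz
      have := (hmemI z).1 (Finset.mem_filter.1 hz).1
      exact ⟨z.2, hsub _ this.1 this.2, rfl⟩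
    · rintro a ha ⟨L₁, a₁⟩ ⟨h₁, e₁⟩ ⟨L₂, a₂⟩ ⟨h₂, e₂⟩
      simp only [I₁, Finset.mem_filter, hmemI] at h₁ h₂
      subst e₁; subst e₂
      have := hinj L₁ h₁.1.1 L₂ h₂.1.1 _ h₁.1.2 h₂.1.2
        (le_antisymm (h₁.2 _ h₂.1.1 h₂.1.2) (h₂.2 _ h₁.1.1 h₁.1.2))
      rw [this]
  have c₂ : I₂.card ≤ 𝓛.card := by
    apply Finset.card_le_card_of_forall_subsingleton
      (fun z L' => R z.2 L' z.1 ∧ ∀ b ∈ f L', m z.2 ≤ m b)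
    · rintro z hz
      obtain ⟨L', hL'⟩ := (Finset.mem_filter.1 hz).2
      exact ⟨L', hL'.1.1, hL'⟩
    · rintro L hL ⟨L₁, a₁⟩ ⟨h₁, e₁⟩ ⟨L₂, a₂⟩ ⟨h₂, e₂⟩
      simp only [I₂, Finset.mem_filter, hmemI] at h₁ h₂
      have e := hm (hsub _ hL e₁.1.2.1) (hsub _ hL e₂.1.2.1)
        (le_antisymm (e₁.2 _ e₂.1.2.1) (e₂.2 _ e₁.1.2.1))
      subst e
      rw [hRinj _ L L₁ L₂ h₁.1.1 h₂.1.1 h₁.1.2 h₂.1.2 e₁.1 e₂.1]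
  have c₃ : I₃.card ≤ 𝓛.card := by
    apply Finset.card_le_card_of_forall_subsingleton
      (fun z L' => ∃ b ∈ f z.1, m z.2 < m b ∧
        (∀ d ∈ f z.1, m z.2 < m d → m b ≤ m d) ∧ R b L' z.1 ∧ ∀ d ∈ f L', m d ≤ m b)
    · rintro z hz
      obtain ⟨L', hL'⟩ := (Finset.mem_filter.1 hz).2
      obtain ⟨b, -, -, -, hR, -⟩ := id hL'
      exact ⟨L', hR.1, hL'⟩
    · rintro L hL ⟨L₁, a₁⟩ ⟨h₁, b₁, hb₁, hab₁, hn₁, hR₁, hM₁⟩ ⟨L₂, a₂⟩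
        ⟨h₂, b₂, hb₂, hab₂, hn₂, hR₂, hM₂⟩
      simp only [I₃, Finset.mem_filter, hmemI] at h₁ h₂
      have e := hm (hsub _ hL hR₁.2.1) (hsub _ hL hR₂.2.1)
        (le_antisymm (hM₂ _ hR₁.2.1) (hM₁ _ hR₂.2.1))
      subst e
      have e := hRinj _ L L₁ L₂ h₁.1.1 h₂.1.1 hb₁ hb₂ hR₁ hR₂
      subst e
      have e : a₁ = a₂ := by
        apply hm (hsub _ h₁.1.1 h₁.1.2) (hsub _ h₁.1.1 h₂.1.2)
        rcases lt_trichotomy (m a₁) (m a₂) with h | h | h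
        · exact absurd (hn₁ a₂ h₂.1.2 h) (not_le.2 hab₂)
        · exact h
        · exact absurd (hn₂ a₁ h₁.1.2 h) (not_le.2 hab₁)
      rw [e]
  have hcover : I ⊆ I₀ ∪ I₁ ∪ (I₂ ∪ I₃) := by
    rintro ⟨L, a⟩ hz
    obtain ⟨hL, ha⟩ := (hmemI _).1 hz
    simp only [Finset.mem_union, I₀, I₁, I₂, I₃, Finset.mem_filter, hz, true_and]
    by_contra! hcon
    obtain ⟨⟨⟨b', hb', hab'⟩, h1⟩, h2, h3⟩ := hcon
    obtain ⟨b, hb, hbmin⟩ := ((f L).filter fun d => m a < m d).exists_min_image m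
      ⟨b', by simp [hb', hab']⟩
    simp only [Finset.mem_filter] at hb hbmin
    obtain ⟨hb, hab⟩ := hb
    obtain ⟨L', hR⟩ := hRex a L h1
    obtain ⟨a', ha', hlt⟩ := h2 L' hR
    have between : ∀ u v w, u ∈ X → w ∈ X → ∀ K₁ ∈ 𝓛, ∀ K₂ ∈ 𝓛, u ∈ f K₁ → v ∈ f K₁ → v ∈ f K₂ →
        w ∈ f K₂ → m u < m v → m v < m w → ∃ K ∈ 𝓛, u ∈ f K ∧ w ∈ f K ∧
          c u - c w = s K * (m u - m w) := by
      intro u v w hu hw K₁ hK₁ K₂ hK₂ _ _ _ _ huv hvw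
      obtain ⟨K, hK, huK, hwK⟩ := hpair u hu w hw (by rintro rfl; linarith)
      exact ⟨K, hK, huK, hwK, hs K hK u huK w hwK⟩
    obtain ⟨K, hK, haK, hbK, hKs⟩ := between a' a b (hsub _ hR.1 ha') (hsub _ hL hb) L' hR.1 L hL
      ha' hR.2.1 ha hb hlt hab
    have e1 := hs L' hR.1 a' ha' a hR.2.1
    have e2 := hs L hL a ha b hb
    have hss := hR.2.2.1
    have hK1 : s L' < s K := by
      nlinarith [mul_pos (sub_pos.2 hss) (sub_pos.2 hab)]
    have hK2 : s K < s L := by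
      nlinarith [mul_pos (sub_pos.2 hss) (sub_pos.2 hlt)]
    obtain ⟨L'', hR'⟩ := hRex b L ⟨K, hK, hbK, hK2⟩
    have hle := hR'.2.2.2 K hK hbK hK2
    obtain ⟨d, hd, hbd⟩ := h3 L'' b hb hab (fun d hd h => hbmin d ⟨hd, h⟩) hR'
    obtain ⟨J, hJ, haJ, hdJ, hJs⟩ := between a b d (hsub _ hL ha) (hsub _ hR'.1 hd) L hL L'' hR'.1
      ha hb hR'.2.1 hd hab hbd
    have e3 := hs L'' hR'.1 b hR'.2.1 d hd
    have hss' := hR'.2.2.1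
    have hJ1 : s L'' < s J := by
      nlinarith [mul_pos (sub_pos.2 hss') (sub_pos.2 hab)]
    have hJ2 : s J < s L := by
      nlinarith [mul_pos (sub_pos.2 hss') (sub_pos.2 hbd)]
    have := hR.2.2.2 J hJ haJ hJ2
    linarith
  have hI : I.card = ∑ L ∈ 𝓛, (f L).card := Finset.card_sigma _ _
  have := Finset.card_le_card hcover
  have := Finset.card_union_le (I₀ ∪ I₁) (I₂ ∪ I₃)
  have := Finset.card_union_le I₀ I₁
  have := Finset.card_union_le I₂ I₃
  omega

theorem mul_card_le_of_linear_space {ι κ : Type*} (X : Finset ι) (𝓛 : Finset κ)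
    (f : κ → Finset ι) (T : ℕ) (hT : 4 ≤ T) (hX : T ^ 2 ≤ X.card)
    (hsub : ∀ L ∈ 𝓛, f L ⊆ X)
    (hpair : ∀ a ∈ X, ∀ b ∈ X, a ≠ b → ∃ L ∈ 𝓛, a ∈ f L ∧ b ∈ f L)
    (huniq : ∀ L ∈ 𝓛, ∀ L' ∈ 𝓛, ∀ a ∈ f L, ∀ b ∈ f L, a ∈ f L' → b ∈ f L' → a ≠ b → L = L')
    (hlarge : ∀ L ∈ 𝓛, (f L).card + T + 1 ≤ X.card) :
    T * X.card ≤ ∑ L ∈ 𝓛, (f L).card := by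
  classical
  let x : ι → ℕ := fun q => (𝓛.filter fun L => q ∈ f L).card
  have hsum : ∑ L ∈ 𝓛, (f L).card = ∑ q ∈ X, x q := by
    have h1 : ∀ L ∈ 𝓛, (f L).card = ∑ q ∈ X, if q ∈ f L then 1 else 0 := by
      intro L hL
      rw [← Finset.sum_filter, Finset.filter_mem_eq_inter,
        Finset.inter_eq_right.2 (hsub L hL), Finset.card_eq_sum_ones]
    rw [Finset.sum_congr rfl h1, Finset.sum_comm]
    simp only [x, Finset.card_filter]
  rw [hsum]
  by_cases hall : ∀ q ∈ X, T ≤ x q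
  · calc T * X.card = ∑ q ∈ X, T := by simp [mul_comm]
      _ ≤ _ := Finset.sum_le_sum hall
  push Not at hall
  obtain ⟨q, hq, hxq⟩ := hall
  obtain ⟨L, hL, hM⟩ : ∃ L ∈ 𝓛, T + 2 ≤ (f L).card := by
    by_contra! hcon
    have h1 : X.erase q ⊆ (𝓛.filter fun L => q ∈ f L).biUnion fun L => (f L).erase q := by
      intro b hb
      obtain ⟨hbq, hb⟩ := Finset.mem_erase.1 hb
      obtain ⟨L, hL, hbL, hqL⟩ := hpair b hb q hq hbq
      simp only [Finset.mem_biUnion, Finset.mem_filter, Finset.mem_erase]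
      exact ⟨L, ⟨hL, hqL⟩, hbq, hbL⟩
    have h2 := (Finset.card_le_card h1).trans (Finset.card_biUnion_le_card_mul _ _ T (by
      intro L hL
      obtain ⟨hL, hqL⟩ := Finset.mem_filter.1 hL
      rw [Finset.card_erase_of_mem hqL]
      have := hcon L hL
      omega))
    rw [Finset.card_erase_of_mem hq] at h2
    change _ ≤ x q * T at h2
    have h3 : x q * T ≤ (T - 1) * T := Nat.mul_le_mul_right _ (by omega)
    obtain ⟨t, rfl⟩ : ∃ t, T = t + 1 := ⟨T - 1, by omega⟩
    rw [Nat.add_sub_cancel] at h3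
    have h5 : (t + 1) ^ 2 ≤ t * (t + 1) + 1 := by omega
    nlinarith
  have hoff : ∀ p ∈ X \ f L, (f L).card ≤ x p := by
    intro p hp
    obtain ⟨hp, hpL⟩ := Finset.mem_sdiff.1 hp
    apply Finset.card_le_card_of_forall_subsingleton (fun b K => b ∈ f K)
    · intro b hb
      obtain ⟨K, hK, hpK, hbK⟩ := hpair p hp b (hsub L hL hb) (by rintro rfl; exact hpL hb)
      exact ⟨K, by simp [hK, hpK], hbK⟩
    · rintro K hK b ⟨hb, hbK⟩ b' ⟨hb', hbK'⟩
      obtain ⟨hK, hpK⟩ := Finset.mem_filter.1 hK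
      by_contra hne
      have := huniq L hL K hK b hb b' hb' hbK hbK' hne
      subst this
      exact hpL hpK
  have hon : ∀ p ∈ f L, 1 ≤ x p := fun p hp =>
    Finset.card_pos.2 ⟨L, by simp [hL, hp]⟩
  have h1 : (X.card - (f L).card) * (f L).card + (f L).card ≤ ∑ q ∈ X, x q := by
    rw [← Finset.sum_sdiff (hsub L hL), ← Finset.card_sdiff_of_subset (hsub L hL)]
    refine add_le_add ?_ ?_
    · simpa using Finset.card_nsmul_le_sum _ _ _ hoff
    · simpa using Finset.card_nsmul_le_sum _ _ _ hon
  refine le_trans ?_ h1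
  have h2 := hlarge L hL
  obtain ⟨u, hu⟩ : ∃ u, X.card = (f L).card + T + 1 + u := ⟨_, (Nat.add_sub_of_le h2).symm⟩
  obtain ⟨v, hv⟩ : ∃ v, (f L).card = T + 2 + v := ⟨_, (Nat.add_sub_of_le hM).symm⟩
  have h3 : X.card - (f L).card = T + 1 + u := by omega
  rw [h3]
  rw [hv] at hu ⊢
  rw [hu] at hX ⊢
  nlinarith [Nat.zero_le (u * v)]

theorem sum_card_add_le_of_linear_space {ι κ : Type*} (𝓛 : Finset κ)
    (f : κ → Finset ι) (N : ℕ) (h2 : ∀ L ∈ 𝓛, 2 ≤ (f L).card)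
    (hsum : ∑ L ∈ 𝓛, (f L).card ≤ 3 * 𝓛.card + N) :
    ∑ L ∈ 𝓛, (f L).card ≤ 6 * (𝓛.filter fun L => (f L).card = 2).card +
      3 * (𝓛.filter fun L => (f L).card = 3).card + 4 * N := by
  have h : ∀ L ∈ 𝓛, 12 ≤ 3 * (f L).card + 6 * (if (f L).card = 2 then 1 else 0) +
      3 * (if (f L).card = 3 then 1 else 0) := by
    intro L hL
    have := h2 L hL
    split_ifs <;> omega
  have := Finset.sum_le_sum h
  simp only [Finset.sum_add_distrib, ← Finset.mul_sum, ← Finset.card_filter, Finset.sum_const,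
    smul_eq_mul] at this
  omega

theorem mul_choose_le_of_steiner {ι : Type*} [DecidableEq ι] (S : Finset ι)
    (𝓑 : Finset (Finset ι)) (hsub : ∀ B ∈ 𝓑, B ⊆ S)
    (hex : ∀ a ∈ S, ∀ b ∈ S, ∀ c ∈ S, a ≠ b → a ≠ c → b ≠ c → ∃ B ∈ 𝓑, a ∈ B ∧ b ∈ B ∧ c ∈ B)
    (huniq : ∀ B ∈ 𝓑, ∀ B' ∈ 𝓑, ∀ a ∈ B, ∀ b ∈ B, ∀ c ∈ B, a ∈ B' → b ∈ B' → c ∈ B' →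
      a ≠ b → a ≠ c → b ≠ c → B = B') (P : Finset ι) (hP : P ∈ 𝓑) :
    (S \ P).card * P.card.choose 2 ≤ (𝓑.filter fun B => B.card = 3).card +
      (𝓑.filter fun B => B.card = 4).card + (S \ P).card.choose 2 * P.card := by
  let 𝓓 := 𝓑.filter fun B => (B ∩ P).card = 2
  have hmem : ∀ B, B ∈ 𝓓 ↔ B ∈ 𝓑 ∧ (B ∩ P).card = 2 := fun B => Finset.mem_filter
  have h1 : (S \ P).card * P.card.choose 2 ≤ ∑ B ∈ 𝓓, (B \ P).card := by
    rw [← Finset.card_powersetCard, ← Finset.card_product, ← Finset.card_sigma]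
    apply Finset.card_le_card_of_forall_subsingleton (fun z w => z.1 = w.2 ∧ z.2 ⊆ w.1)
    · rintro ⟨p, e⟩ hz
      obtain ⟨hp, he⟩ := Finset.mem_product.1 hz
      obtain ⟨hp, hpP⟩ := Finset.mem_sdiff.1 hp
      obtain ⟨heP, he⟩ := Finset.mem_powersetCard.1 he
      obtain ⟨a, b, hab, rfl⟩ := Finset.card_eq_two.1 he
      have haP : a ∈ P := heP (by simp)
      have hbP : b ∈ P := heP (by simp)
      have hpa : p ≠ a := by rintro rfl; exact hpP haP
      have hpb : p ≠ b := by rintro rfl; exact hpP hbP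
      obtain ⟨B, hB, hpB, haB, hbB⟩ := hex p hp a (hsub P hP haP) b (hsub P hP hbP) hpa hpb hab
      have hBP : B ∩ P = {a, b} := by
        apply Finset.Subset.antisymm
        · intro c hc
          obtain ⟨hcB, hcP⟩ := Finset.mem_inter.1 hc
          by_contra hcon
          simp only [Finset.mem_insert, Finset.mem_singleton, not_or] at hcon
          have := huniq B hB P hP a haB b hbB c hcB haP hbP hcP hab (Ne.symm hcon.1)
            (Ne.symm hcon.2)
          exact hpP (this ▸ hpB)
        · intro c hc
          rcases Finset.mem_insert.1 hc with rfl | hc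
          · exact Finset.mem_inter.2 ⟨haB, haP⟩
          · rw [Finset.mem_singleton.1 hc]
            exact Finset.mem_inter.2 ⟨hbB, hbP⟩
      refine ⟨⟨B, p⟩, ?_, rfl, ?_⟩
      · rw [Finset.mem_sigma, hmem]
        exact ⟨⟨hB, by rw [hBP, he]⟩, Finset.mem_sdiff.2 ⟨hpB, hpP⟩⟩
      · exact hBP ▸ Finset.inter_subset_left
    · rintro ⟨B, p⟩ hw ⟨p₁, e₁⟩ ⟨h₁, hp₁, hs₁⟩ ⟨p₂, e₂⟩ ⟨h₂, hp₂, hs₂⟩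
      simp only [Finset.mem_sigma, hmem] at hw
      simp only [Finset.mem_product, Finset.mem_powersetCard] at h₁ h₂ hp₁ hp₂
      have key : ∀ e : Finset ι, e ⊆ B → e ⊆ P → e.card = 2 → e = B ∩ P := fun e h h' hc =>
        Finset.eq_of_subset_of_card_le (Finset.subset_inter h h') (by rw [hc, hw.1.2])
      rw [hp₁, hp₂, key e₁ hs₁ h₁.2.1 h₁.2.2, key e₂ hs₂ h₂.2.1 h₂.2.2]
  have h2 : ∑ B ∈ 𝓓, (B \ P).card.choose 2 ≤ (S \ P).card.choose 2 * P.card := by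
    simp_rw [← Finset.card_powersetCard]
    rw [← Finset.card_product, ← Finset.card_sigma]
    apply Finset.card_le_card_of_forall_subsingleton (fun z w => z.2 = w.1 ∧ w.2 ∈ z.1)
    · rintro ⟨B, e⟩ hz
      simp only [Finset.mem_sigma, hmem, Finset.mem_powersetCard] at hz
      obtain ⟨⟨hB, hc⟩, he, hec⟩ := hz
      obtain ⟨a, ha⟩ : (B ∩ P).Nonempty := Finset.card_pos.1 (by omega)
      obtain ⟨haB, haP⟩ := Finset.mem_inter.1 ha
      refine ⟨(e, a), ?_, rfl, haB⟩
      rw [Finset.mem_product, Finset.mem_powersetCard]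
      exact ⟨⟨he.trans (Finset.sdiff_subset_sdiff (hsub B hB) le_rfl), hec⟩, haP⟩
    · rintro ⟨e, a⟩ hw ⟨B₁, e₁⟩ ⟨h₁, he₁, ha₁⟩ ⟨B₂, e₂⟩ ⟨h₂, he₂, ha₂⟩
      simp only [Finset.mem_product, Finset.mem_sigma, hmem, Finset.mem_powersetCard] at *
      subst he₁; subst he₂
      obtain ⟨p, q, hpq, rfl⟩ := Finset.card_eq_two.1 hw.1.2
      have hp : p ∈ S \ P := hw.1.1 (by simp)
      have hq : q ∈ S \ P := hw.1.1 (by simp)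
      have hne : ∀ r ∈ S \ P, r ≠ a := by
        rintro r hr rfl
        exact (Finset.mem_sdiff.1 hr).2 hw.2
      have sub₁ := h₁.2.1.trans Finset.sdiff_subset
      have sub₂ := h₂.2.1.trans Finset.sdiff_subset
      rw [huniq B₁ h₁.1.1 B₂ h₂.1.1 p (sub₁ (by simp)) q (sub₁ (by simp)) a ha₁
        (sub₂ (by simp)) (sub₂ (by simp)) ha₂ hpq (hne p hp) (hne q hq)]
  have h3 : ∑ B ∈ 𝓓, (B \ P).card ≤ ∑ B ∈ 𝓓, ((if B.card = 3 then 1 else 0) +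
      (if B.card = 4 then 1 else 0) + (B \ P).card.choose 2) := by
    apply Finset.sum_le_sum
    intro B hB
    have h := Finset.card_sdiff_add_card_inter B P
    rw [((hmem B).1 hB).2] at h
    generalize (B \ P).card = d at h ⊢
    rw [← h]
    match d with
    | 0 => simp
    | 1 => simp
    | 2 => simp
    | d + 3 =>
      have : d + 3 ≤ (d + 3).choose 2 := by
        rw [Nat.choose_two_right, Nat.le_div_iff_mul_le (by norm_num)]
        exact Nat.mul_le_mul_left _ (by omega)
      omega
  simp only [Finset.sum_add_distrib, ← Finset.card_filter] at h3
  have h4 : ∀ i, (𝓓.filter fun B => B.card = i).card ≤ (𝓑.filter fun B => B.card = i).card :=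
    fun i => Finset.card_le_card (Finset.filter_subset_filter _ (Finset.filter_subset _ _))
  have := h4 3
  have := h4 4
  omega

theorem card_three_add_card_four_ge_of_steiner {ι : Type*} [DecidableEq ι] (S : Finset ι)
    (𝓑 : Finset (Finset ι)) (hsub : ∀ B ∈ 𝓑, B ⊆ S) (hthree : ∀ B ∈ 𝓑, 3 ≤ B.card)
    (hex : ∀ a ∈ S, ∀ b ∈ S, ∀ c ∈ S, a ≠ b → a ≠ c → b ≠ c → ∃ B ∈ 𝓑, a ∈ B ∧ b ∈ B ∧ c ∈ B)
    (huniq : ∀ B ∈ 𝓑, ∀ B' ∈ 𝓑, ∀ a ∈ B, ∀ b ∈ B, ∀ c ∈ B, a ∈ B' → b ∈ B' → c ∈ B' →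
      a ≠ b → a ≠ c → b ≠ c → B = B')
    (hlink : ∀ p ∈ S, ∑ B ∈ 𝓑 with p ∈ B, (B.erase p).card ≤
      3 * (𝓑.filter fun B => p ∈ B).card + (S.erase p).card)
    (n k : ℕ) (hn : S.card = n) (hk : 1 ≤ k) (hcap : ∀ B ∈ 𝓑, B.card + k ≤ n)
    (hbig : (n : ℝ) ≥ (184 + 8 / 25) * k ^ 2 + 4 * k) :
    (((𝓑.filter fun B => B.card = 3).card + (𝓑.filter fun B => B.card = 4).card : ℕ) : ℝ) ≥
      (k : ℝ) * ((n - k).choose 2 : ℝ) - ((n : ℝ) - k) * (k.choose 2 : ℝ) := by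
  have hk' : (1 : ℝ) ≤ k := by exact_mod_cast hk
  have hkn : k ≤ n := by
    have : (k : ℝ) ≤ n := by nlinarith
    exact_mod_cast this
  by_cases hplane : ∃ P ∈ 𝓑, n ≤ P.card + (9 * k + 4)
  · obtain ⟨P, hP, hPn⟩ := hplane
    have hmain := mul_choose_le_of_steiner S 𝓑 hsub hex huniq P hP
    have hPk := hcap P hP
    have hj : (S \ P).card + P.card = n := by
      rw [Finset.card_sdiff_add_card_eq_card (hsub P hP), hn]
    generalize (S \ P).card = j at hmain hj
    generalize P.card = M at *
    have hmain' := (Nat.cast_le (α := ℝ)).2 hmain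
    push_cast [Nat.cast_choose_two] at hmain' ⊢
    rw [Nat.cast_sub hkn]
    have hM : (M : ℝ) = n - j := by rw [← hj]; push_cast; ring
    have hjk : (k : ℝ) ≤ j := by exact_mod_cast (by omega : k ≤ j)
    have hjk' : (j : ℝ) ≤ 9 * k + 4 := by exact_mod_cast (by omega : j ≤ 9 * k + 4)
    rw [hM] at hmain'
    have hbig' : 0 ≤ (n : ℝ) - 3 * (j + k) := by nlinarith
    have : 0 ≤ ((j : ℝ) - k) * (n * (n - 3 * (j + k)) + 2 * (j ^ 2 + j * k + k ^ 2)) := by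
      apply mul_nonneg (sub_nonneg.2 hjk)
      positivity
    nlinarith
  · push Not at hplane
    have hT : (9 * k + 4) ^ 2 + 1 ≤ n := by
      have : (9 * (k : ℝ) + 4) ^ 2 + 1 ≤ n := by nlinarith
      exact_mod_cast this
    have hpt : ∀ p ∈ S, 9 * k * (n - 1) ≤
        6 * (𝓑.filter fun B => p ∈ B ∧ B.card = 3).card +
        3 * (𝓑.filter fun B => p ∈ B ∧ B.card = 4).card := by
      intro p hp
      have hmem : ∀ B, B ∈ 𝓑.filter (fun B => p ∈ B) ↔ B ∈ 𝓑 ∧ p ∈ B := fun B =>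
        Finset.mem_filter
      have hX : (S.erase p).card = n - 1 := by rw [Finset.card_erase_of_mem hp, hn]
      have hcard : ∀ B ∈ 𝓑.filter (fun B => p ∈ B), (B.erase p).card + 1 = B.card :=
        fun B hB => Finset.card_erase_add_one ((hmem B).1 hB).2
      have hA := mul_card_le_of_linear_space (S.erase p) (𝓑.filter fun B => p ∈ B)
        (fun B => B.erase p) (9 * k + 4) (by omega) (by omega)
        (fun B hB => Finset.erase_subset_erase _ (hsub B ((hmem B).1 hB).1))
        (by
          intro a ha b hb hab
          obtain ⟨hap, ha⟩ := Finset.mem_erase.1 ha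
          obtain ⟨hbp, hb⟩ := Finset.mem_erase.1 hb
          obtain ⟨B, hB, hpB, haB, hbB⟩ := hex p hp a ha b hb (Ne.symm hap) (Ne.symm hbp) hab
          exact ⟨B, (hmem B).2 ⟨hB, hpB⟩, Finset.mem_erase.2 ⟨hap, haB⟩,
            Finset.mem_erase.2 ⟨hbp, hbB⟩⟩)
        (by
          intro B hB B' hB' a ha b hb ha' hb' hab
          rw [Finset.mem_erase] at ha hb ha' hb'
          rw [hmem] at hB hB'
          exact huniq B hB.1 B' hB'.1 p hB.2 a ha.2 b hb.2 hB'.2 ha'.2 hb'.2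
            (Ne.symm ha.1) (Ne.symm hb.1) hab)
        (by
          intro B hB
          have := hcard B hB
          have := hplane B ((hmem B).1 hB).1
          omega)
      have hB := sum_card_add_le_of_linear_space (𝓑.filter fun B => p ∈ B)
        (fun B => B.erase p) (S.erase p).card
        (by
          intro B hB
          have := hcard B hB
          have := hthree B ((hmem B).1 hB).1
          omega) (hlink p hp)
      have hC : ∀ i, (𝓑.filter fun B => p ∈ B).filter (fun B => (B.erase p).card = i) =
          𝓑.filter fun B => p ∈ B ∧ B.card = i + 1 := by
        intro i
        rw [Finset.filter_filter]
        apply Finset.filter_congr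
        intro B hB
        refine and_congr_right fun hpB => ?_
        have := hcard B ((hmem B).2 ⟨hB, hpB⟩)
        omega
      simp only [hC, Nat.reduceAdd] at hB
      rw [hX] at hB
      rw [hX] at hA
      have := hA.trans hB
      rw [add_mul] at this
      omega
    have hcount : ∀ i, ∑ p ∈ S, (𝓑.filter fun B => p ∈ B ∧ B.card = i).card =
        i * (𝓑.filter fun B => B.card = i).card := by
      intro i
      have h1 : ∀ p ∈ S, (𝓑.filter fun B => p ∈ B ∧ B.card = i).card =
          ∑ B ∈ 𝓑 with B.card = i, if p ∈ B then 1 else 0 := by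
        intro p _
        rw [← Finset.card_filter, Finset.filter_filter]
        simp only [and_comm]
      rw [Finset.sum_congr rfl h1, Finset.sum_comm]
      have h2 : ∀ B ∈ 𝓑.filter (fun B => B.card = i),
          (∑ p ∈ S, if p ∈ B then 1 else 0) = i := by
        intro B hB
        obtain ⟨hB, hi⟩ := Finset.mem_filter.1 hB
        rw [← Finset.card_filter, Finset.filter_mem_eq_inter,
          Finset.inter_eq_right.2 (hsub B hB), hi]
      rw [Finset.sum_congr rfl h2, Finset.sum_const, smul_eq_mul, mul_comm]
    have hsum := Finset.sum_le_sum hpt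
    simp only [Finset.sum_add_distrib, ← Finset.mul_sum, hcount, Finset.sum_const,
      smul_eq_mul, hn] at hsum
    generalize (𝓑.filter fun B => B.card = 3).card = x at *
    generalize (𝓑.filter fun B => B.card = 4).card = y at *
    have hsum' : (n : ℝ) * (9 * k * (n - 1)) ≤ 18 * (x + y) := by
      have h : n * (9 * k * (n - 1)) ≤ 18 * (x + y) := by
        rw [mul_left_comm]
        omega
      have h' := (Nat.cast_le (α := ℝ)).2 h
      rw [Nat.cast_mul, Nat.cast_mul, Nat.cast_sub (by omega)] at h'
      push_cast at h'
      exact h'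
    push_cast [Nat.cast_choose_two]
    rw [Nat.cast_sub hkn]
    have hkn' : (k : ℝ) ≤ n := by exact_mod_cast hkn
    have e1 : 0 ≤ ((n : ℝ) - k) * (k * (k - 1)) := by
      apply mul_nonneg (by linarith)
      apply mul_nonneg <;> linarith
    have e2 : 0 ≤ (k : ℝ) * (k * (2 * n - 1 - k)) := by
      have : (0 : ℝ) ≤ 2 * n - 1 - k := by linarith
      positivity
    nlinarith

theorem IsPlane.eq_affineSpan_s14 {P : Set Pt3} (hP : IsPlane P) {a b c : Pt3}
    (h : AffineIndependent ℝ ![a, b, c]) (ha : a ∈ P) (hb : b ∈ P) (hc : c ∈ P) :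
    P = (affineSpan ℝ ({a, b, c} : Set Pt3) : Set Pt3) := by
  obtain ⟨x, y, z, hxyz, rfl⟩ := hP
  have hrange : ∀ u v w : Pt3, Set.range ![u, v, w] = {u, v, w} := fun u v w => by
    simp_rw [Matrix.range_cons, Matrix.range_empty, Set.singleton_union, insert_empty_eq]
  have hfin := hxyz.finrank_vectorSpan (n := 2) (by simp)
  have := h.affineSpan_eq_of_le_of_card_eq_finrank_add_one
    (sp := affineSpan ℝ (Set.range ![x, y, z])) (by
      rw [affineSpan_le, hrange, hrange]
      rintro q (rfl | rfl | rfl) <;> assumption) (by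
      rw [direction_affineSpan, hfin]; simp)
  rw [hrange, hrange] at this
  rw [this]

theorem mem_affineSpan_triple_iff {p a b q : Pt3} :
    q ∈ affineSpan ℝ ({p, a, b} : Set Pt3) ↔
      ∃ α β : ℝ, α • (a - p) + β • (b - p) = q - p := by
  have hp : p ∈ affineSpan ℝ ({p, a, b} : Set Pt3) := subset_affineSpan ℝ _ (by simp)
  rw [← AffineSubspace.vsub_right_mem_direction_iff_mem hp, direction_affineSpan,
    vectorSpan_eq_span_vsub_set_right ℝ (p := p) (by simp)]
  simp only [Set.image_insert_eq, Set.image_singleton, vsub_eq_sub, sub_self,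
    Submodule.span_insert_zero, Submodule.mem_span_pair]

theorem exists_dual_forall_mem_ne_zero {V : Type*} [AddCommGroup V] [Module ℝ V]
    (F : Finset V) : ∃ φ : Module.Dual ℝ V, ∀ x ∈ F, x ≠ 0 → φ x ≠ 0 := by
  classical
  obtain ⟨φ, hφ⟩ := Module.exists_dual_forall_apply_ne_zero (K := ℝ)
    (fun x : {x // x ∈ F.filter (· ≠ 0)} => (x : V)) (fun x => (Finset.mem_filter.1 x.2).2)
  exact ⟨φ, fun x hx h0 => hφ ⟨x, Finset.mem_filter.2 ⟨hx, h0⟩⟩⟩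

open Classical in
/-- The traces on `S` of the planes determined by `S`. -/
def planeSections (S : Finset Pt3) : Finset (Finset Pt3) :=
  S.powerset.filter fun B => 3 ≤ B.card ∧ ∃ P, IsPlane P ∧ B = S.filter (· ∈ P)

theorem mem_planeSections {S B : Finset Pt3} :
    B ∈ planeSections S ↔ B ⊆ S ∧ 3 ≤ B.card ∧
      ∃ P, IsPlane P ∧ ∀ q, q ∈ B ↔ q ∈ S ∧ q ∈ P := by
  simp [planeSections, Finset.ext_iff]

theorem exists_mem_planeSections {S : Finset Pt3}
    (hS : ∀ a ∈ S, ∀ b ∈ S, ∀ c ∈ S, a ≠ b → a ≠ c → b ≠ c → AffineIndependent ℝ ![a, b, c])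
    {a b c : Pt3} (ha : a ∈ S) (hb : b ∈ S) (hc : c ∈ S)
    (hab : a ≠ b) (hac : a ≠ c) (hbc : b ≠ c) :
    ∃ B ∈ planeSections S, a ∈ B ∧ b ∈ B ∧ c ∈ B := by
  classical
  let P : Set Pt3 := affineSpan ℝ ({a, b, c} : Set Pt3)
  have hsub : ({a, b, c} : Set Pt3) ⊆ P := subset_affineSpan ℝ _
  have hmem : a ∈ S.filter (· ∈ P) ∧ b ∈ S.filter (· ∈ P) ∧ c ∈ S.filter (· ∈ P) := by
    simp only [Finset.mem_filter]
    exact ⟨⟨ha, hsub (by simp)⟩, ⟨hb, hsub (by simp)⟩, ⟨hc, hsub (by simp)⟩⟩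
  refine ⟨S.filter (· ∈ P), mem_planeSections.2 ⟨Finset.filter_subset _ _, ?_,
    P, ⟨a, b, c, hS a ha b hb c hc hab hac hbc, rfl⟩, fun q => Finset.mem_filter⟩, hmem⟩
  exact Finset.two_lt_card.2 ⟨a, hmem.1, b, hmem.2.1, c, hmem.2.2, hab, hac, hbc⟩

theorem eq_of_mem_planeSections {S : Finset Pt3}
    (hS : ∀ a ∈ S, ∀ b ∈ S, ∀ c ∈ S, a ≠ b → a ≠ c → b ≠ c → AffineIndependent ℝ ![a, b, c])
    {B B' : Finset Pt3} (hB : B ∈ planeSections S)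
    (hB' : B' ∈ planeSections S) {a b c : Pt3} (ha : a ∈ B) (hb : b ∈ B) (hc : c ∈ B)
    (ha' : a ∈ B') (hb' : b ∈ B') (hc' : c ∈ B') (hab : a ≠ b) (hac : a ≠ c) (hbc : b ≠ c) :
    B = B' := by
  obtain ⟨hsub, -, P, hP, hBP⟩ := mem_planeSections.1 hB
  obtain ⟨-, -, P', hP', hBP'⟩ := mem_planeSections.1 hB'
  have hi := hS a (hsub ha) b (hsub hb) c (hsub hc) hab hac hbc
  have e := (hP.eq_affineSpan_s14 hi ((hBP a).1 ha).2 ((hBP b).1 hb).2 ((hBP c).1 hc).2).trans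
    (hP'.eq_affineSpan_s14 hi ((hBP' a).1 ha').2 ((hBP' b).1 hb').2 ((hBP' c).1 hc').2).symm
  ext q
  rw [hBP, hBP', e]

theorem exists_combination_of_mem_planeSections {S : Finset Pt3}
    (hS : ∀ a ∈ S, ∀ b ∈ S, ∀ c ∈ S, a ≠ b → a ≠ c → b ≠ c → AffineIndependent ℝ ![a, b, c])
    {B : Finset Pt3} (hB : B ∈ planeSections S)
    {p a b q : Pt3} (hp : p ∈ B) (ha : a ∈ B) (hb : b ∈ B) (hq : q ∈ S)
    (hpa : p ≠ a) (hpb : p ≠ b) (hab : a ≠ b) :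
    q ∈ B ↔ ∃ α β : ℝ, α • (a - p) + β • (b - p) = q - p := by
  obtain ⟨hsub, -, P, hP, hBP⟩ := mem_planeSections.1 hB
  have hi := hS p (hsub hp) a (hsub ha) b (hsub hb) hpa hpb hab
  have e := hP.eq_affineSpan_s14 hi ((hBP p).1 hp).2 ((hBP a).1 ha).2 ((hBP b).1 hb).2
  rw [hBP, ← mem_affineSpan_triple_iff, e]
  simp [hq]

theorem sum_card_erase_planeSections_le {S : Finset Pt3}
    (hS : ∀ a ∈ S, ∀ b ∈ S, ∀ c ∈ S, a ≠ b → a ≠ c → b ≠ c → AffineIndependent ℝ ![a, b, c])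
    [DecidableEq Pt3] {p : Pt3} (hp : p ∈ S) :
    ∑ B ∈ planeSections S with p ∈ B, (B.erase p).card ≤
      3 * ((planeSections S).filter fun B => p ∈ B).card + (S.erase p).card := by
  have hX : ∀ {q}, q ∈ S.erase p → q ≠ p ∧ q ∈ S := fun h => Finset.mem_erase.1 h
  obtain ⟨h, hh⟩ := exists_dual_forall_mem_ne_zero ((S.erase p).image fun q => q - p)
  have hh0 : ∀ q ∈ S.erase p, h (q - p) ≠ 0 := fun q hq =>
    hh _ (Finset.mem_image_of_mem _ hq) (sub_ne_zero.2 (hX hq).1)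
  let v : Pt3 → Pt3 := fun q => (h (q - p))⁻¹ • (q - p)
  have hv : ∀ q ∈ S.erase p, q - p = h (q - p) • v q := fun q hq =>
    (smul_inv_smul₀ (hh0 q hq) _).symm
  have hv1 : ∀ q ∈ S.erase p, h (v q) = 1 := fun q hq => by
    simp only [v, map_smul, smul_eq_mul]
    exact inv_mul_cancel₀ (hh0 q hq)
  have hvne : ∀ a ∈ S.erase p, ∀ b ∈ S.erase p, a ≠ b → v a - v b ≠ 0 := by
    intro a ha b hb hab h0
    have e : v a = v b := sub_eq_zero.1 h0
    have hi := hS p hp a (hX ha).2 b (hX hb).2 (hX ha).1.symm (hX hb).1.symm hab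
    rw [affineIndependent_iff_not_collinear_set] at hi
    apply hi
    rw [collinear_iff_of_mem (p₀ := p) (by simp)]
    refine ⟨v a, ?_⟩
    rintro q (rfl | rfl | rfl)
    · exact ⟨0, by simp⟩
    · exact ⟨h (q - p), by rw [← hv q ha]; simp⟩
    · exact ⟨h (q - p), by rw [e, ← hv q hb]; simp⟩
  obtain ⟨f, hf⟩ := exists_dual_forall_mem_ne_zero
    ((S.erase p ×ˢ S.erase p).image fun z => v z.1 - v z.2)
  let m : Pt3 → ℝ := fun q => f (v q)
  have hm : ∀ a ∈ S.erase p, ∀ b ∈ S.erase p, a ≠ b → m a - m b ≠ 0 := by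
    intro a ha b hb hab
    have := hf (v a - v b)
      (Finset.mem_image.2 ⟨(a, b), Finset.mem_product.2 ⟨ha, hb⟩, rfl⟩) (hvne a ha b hb hab)
    rwa [map_sub] at this
  let w : Pt3 → Pt3 → Pt3 := fun a b => (m b - m a)⁻¹ • (v b - v a)
  obtain ⟨g, hg⟩ := exists_dual_forall_mem_ne_zero
    ((S.erase p ×ˢ S.erase p ×ˢ S.erase p).image fun z => w z.1 z.2.1 - w z.1 z.2.2)
  let c : Pt3 → ℝ := fun q => g (v q)
  have hw : ∀ a ∈ S.erase p, ∀ b ∈ S.erase p, ∀ b' ∈ S.erase p,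
      g (w a b) = g (w a b') → w a b = w a b' := by
    intro a ha b hb b' hb' hgw
    by_contra hne
    have := hg (w a b - w a b') (Finset.mem_image.2 ⟨(a, b, b'), Finset.mem_product.2
      ⟨ha, Finset.mem_product.2 ⟨hb, hb'⟩⟩, rfl⟩) (sub_ne_zero.2 hne)
    exact this (by rw [map_sub, hgw, sub_self])
  have hmemL : ∀ B, B ∈ (planeSections S).filter (fun B => p ∈ B) ↔
      B ∈ planeSections S ∧ p ∈ B := fun B => Finset.mem_filter
  have herase : ∀ B ∈ (planeSections S).filter (fun B => p ∈ B), B.erase p ⊆ S.erase p :=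
    fun B hB => Finset.erase_subset_erase _ (mem_planeSections.1 ((hmemL B).1 hB).1).1
  have hother : ∀ B ∈ (planeSections S).filter (fun B => p ∈ B), ∀ a ∈ B.erase p,
      ∃ b ∈ B.erase p, a ≠ b := by
    intro B hB a ha
    have h3 := (mem_planeSections.1 ((hmemL B).1 hB).1).2.1
    have : 1 < (B.erase p).card := by
      rw [Finset.card_erase_of_mem ((hmemL B).1 hB).2]
      omega
    obtain ⟨b, hb, hba⟩ := Finset.exists_mem_ne this a
    exact ⟨b, hb, hba.symm⟩
  have hslope : ∀ B ∈ (planeSections S).filter (fun B => p ∈ B), ∃ s : ℝ,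
      ∀ a ∈ B.erase p, ∀ b ∈ B.erase p, c a - c b = s * (m a - m b) := by
    intro B hB
    by_cases hne : (B.erase p).Nonempty
    swap
    · exact ⟨0, fun a ha => (hne ⟨a, ha⟩).elim⟩
    obtain ⟨a, ha⟩ := hne
    obtain ⟨b, hb, hab⟩ := hother B hB a ha
    have ha' := herase B hB ha
    have hb' := herase B hB hb
    have hmab := hm b hb' a ha' hab.symm
    have key : ∀ q ∈ B.erase p,
        c q - c a = (c b - c a) / (m b - m a) * (m q - m a) := by
      intro q hq
      have hq' := herase B hB hq
      obtain ⟨α, β, e⟩ := (exists_combination_of_mem_planeSections hS ((hmemL B).1 hB).1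
        ((hmemL B).1 hB).2 (Finset.mem_of_mem_erase ha) (Finset.mem_of_mem_erase hb)
        (hX hq').2 (hX ha').1.symm (hX hb').1.symm hab).1 (Finset.mem_of_mem_erase hq)
      have e₁ : α • h (a - p) • v a + β • h (b - p) • v b = q - p := by
        rw [← hv a ha', ← hv b hb', e]
      have e' : v q = ((h (q - p))⁻¹ * (α * h (a - p))) • v a +
          ((h (q - p))⁻¹ * (β * h (b - p))) • v b := by
        change (h (q - p))⁻¹ • (q - p) = _
        rw [← e₁]
        module
      generalize (h (q - p))⁻¹ * (α * h (a - p)) = x at e'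
      generalize (h (q - p))⁻¹ * (β * h (b - p)) = y at e'
      have eh := congrArg h e'
      have em := congrArg f e'
      have ec := congrArg g e'
      simp only [map_add, map_smul, smul_eq_mul, hv1 q hq', hv1 a ha', hv1 b hb'] at eh em ec
      change m q = x * m a + y * m b at em
      change c q = x * c a + y * c b at ec
      have hx : x = 1 - y := by linarith
      rw [em, ec, hx]
      field_simp
      ring
    refine ⟨(c b - c a) / (m b - m a), fun q hq r hr => ?_⟩
    linear_combination key q hq - key r hr
  choose! s hs using hslope
  refine sum_card_le_of_slopes (S.erase p) ((planeSections S).filter fun B => p ∈ B)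
    (fun B => B.erase p) m c s ?_ herase ?_ hs ?_
  · intro a ha b hb hab
    by_contra hne
    exact hm a ha b hb hne (sub_eq_zero.2 hab)
  · intro a ha b hb hab
    obtain ⟨B, hB, hpB, haB, hbB⟩ := exists_mem_planeSections hS hp (hX ha).2 (hX hb).2
      (hX ha).1.symm (hX hb).1.symm hab
    exact ⟨B, (hmemL B).2 ⟨hB, hpB⟩, Finset.mem_erase.2 ⟨(hX ha).1, haB⟩,
      Finset.mem_erase.2 ⟨(hX hb).1, hbB⟩⟩
  · intro B hB B' hB' a ha ha' hss
    obtain ⟨b, hb, hab⟩ := hother B hB a ha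
    obtain ⟨b', hb', hab'⟩ := hother B' hB' a ha'
    have haX := herase B hB ha
    have hbX := herase B hB hb
    have hbX' := herase B' hB' hb'
    have hgw : ∀ K ∈ (planeSections S).filter (fun B => p ∈ B), ∀ d ∈ K.erase p,
        a ∈ K.erase p → a ≠ d → g (w a d) = s K := by
      intro K hK d hd haK had
      have hne := hm d (herase K hK hd) a haX had.symm
      have := hs K hK d hd a haK
      simp only [w, map_smul, map_sub, smul_eq_mul]
      change (m d - m a)⁻¹ * (c d - c a) = s K
      rw [this]
      field_simp
    have hww := hw a haX b hbX b' hbX'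
      ((hgw B hB b hb ha hab).trans (hss.trans (hgw B' hB' b' hb' ha' hab').symm))
    have hvb' : v b' = v a + (m b' - m a) • w a b := by
      rw [hww]
      simp only [w]
      rw [smul_inv_smul₀ (hm b' hbX' a haX hab'.symm)]
      abel
    have hb'B : b' ∈ B := by
      refine (exists_combination_of_mem_planeSections hS ((hmemL B).1 hB).1
        ((hmemL B).1 hB).2 (Finset.mem_of_mem_erase ha) (Finset.mem_of_mem_erase hb)
        (hX hbX').2 (hX haX).1.symm (hX hbX).1.symm hab).2 ?_
      rw [hv b' hbX', hvb']
      simp only [w, v]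
      refine ⟨h (b' - p) * (1 - (m b' - m a) * (m b - m a)⁻¹) * (h (a - p))⁻¹,
        h (b' - p) * ((m b' - m a) * (m b - m a)⁻¹) * (h (b - p))⁻¹, ?_⟩
      module
    exact eq_of_mem_planeSections hS ((hmemL B).1 hB).1 ((hmemL B').1 hB').1
      ((hmemL B).1 hB).2 (Finset.mem_of_mem_erase ha) hb'B ((hmemL B').1 hB').2
      (Finset.mem_of_mem_erase ha') (Finset.mem_of_mem_erase hb')
      (hX haX).1.symm (hX hbX').1.symm hab'

theorem planeCount_eq_card_filter_planeSections {S : Finset Pt3}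
    (hS : ∀ a ∈ S, ∀ b ∈ S, ∀ c ∈ S, a ≠ b → a ≠ c → b ≠ c → AffineIndependent ℝ ![a, b, c])
    {i : ℕ} (hi : 3 ≤ i) :
    planeCount (S : Set Pt3) i = ((planeSections S).filter fun B => B.card = i).card := by
  classical
  have hncard : ∀ P : Set Pt3, ((S : Set Pt3) ∩ P).ncard = (S.filter (· ∈ P)).card := by
    intro P
    rw [← Set.ncard_coe_finset]
    congr 1
    ext q
    simp
  have himage : (fun P : Set Pt3 => S.filter (· ∈ P)) ''
      {P : Set Pt3 | IsPlane P ∧ ((S : Set Pt3) ∩ P).ncard = i} =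
      ((planeSections S).filter fun B => B.card = i : Finset (Finset Pt3)) := by
    ext B
    simp only [Set.mem_image, Finset.coe_filter, Set.mem_ofPred_eq, mem_planeSections, hncard]
    constructor
    · rintro ⟨P, ⟨hP, hc⟩, rfl⟩
      exact ⟨⟨Finset.filter_subset _ _, by omega, P, hP, fun q => Finset.mem_filter⟩, hc⟩
    · rintro ⟨⟨hsub, h3, P, hP, hBP⟩, hc⟩
      have e : S.filter (· ∈ P) = B := by
        ext q
        rw [hBP, Finset.mem_filter]
      exact ⟨P, ⟨hP, e ▸ hc⟩, e⟩
  rw [← Set.ncard_coe_finset, ← himage, planeCount, Set.InjOn.ncard_image]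
  rintro P ⟨hP, hc⟩ P' ⟨hP', -⟩ e
  dsimp only at e
  rw [hncard] at hc
  obtain ⟨a, b, c, ha, hb, hcc, hab, hac, hbc⟩ := Finset.two_lt_card_iff.1
    (show 2 < (S.filter (· ∈ P)).card by omega)
  have ha' := e ▸ ha
  have hb' := e ▸ hb
  have hc' := e ▸ hcc
  rw [Finset.mem_filter] at ha hb hcc ha' hb' hc'
  have hi := hS a ha.1 b hb.1 c hcc.1 hab hac hbc
  rw [hP.eq_affineSpan_s14 hi ha.2 hb.2 hcc.2, hP'.eq_affineSpan_s14 hi ha'.2 hb'.2 hc'.2]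

theorem stmt14 (S : Set Pt3) (hS : S.Finite) (n k : ℕ) (hn : S.ncard = n)
    (h3 : NoThreeCollinear S) (hk : 1 ≤ k)
    (hbig : (n : ℝ) ≥ (184 + 8 / 25) * k ^ 2 + 4 * k)
    (hcap : ∀ P : Set Pt3, IsPlane P → ((S ∩ P).ncard : ℤ) ≤ (n : ℤ) - k) :
    ((planeCount S 3 + planeCount S 4 : ℕ) : ℝ) ≥
      (k : ℝ) * ((n - k).choose 2 : ℝ) - ((n : ℝ) - k) * (k.choose 2 : ℝ) := by
  classical
  obtain ⟨F, rfl⟩ := hS.exists_finset_coe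
  have hF : ∀ a ∈ F, ∀ b ∈ F, ∀ c ∈ F, a ≠ b → a ≠ c → b ≠ c →
      AffineIndependent ℝ ![a, b, c] := by
    intro a ha b hb c hc hab hac hbc
    rw [affineIndependent_iff_not_collinear_set]
    apply h3
    · rintro q (rfl | rfl | rfl) <;> assumption
    · exact Set.ncard_eq_three.2 ⟨a, b, c, hab, hac, hbc, rfl⟩
  rw [planeCount_eq_card_filter_planeSections hF le_rfl,
    planeCount_eq_card_filter_planeSections hF (by norm_num)]
  rw [Set.ncard_coe_finset] at hn
  refine card_three_add_card_four_ge_of_steiner F (planeSections F)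
    (fun B hB => (mem_planeSections.1 hB).1) (fun B hB => (mem_planeSections.1 hB).2.1)
    (fun a ha b hb c hc => exists_mem_planeSections hF ha hb hc)
    (fun B hB B' hB' a ha b hb c hc => eq_of_mem_planeSections hF hB hB' ha hb hc)
    (fun p hp => sum_card_erase_planeSections_le hF hp) n k hn hk ?_ hbig
  intro B hB
  obtain ⟨-, -, P, hP, hBP⟩ := mem_planeSections.1 hB
  have e : (F : Set Pt3) ∩ P = B := by
    ext q
    simp [hBP]
  have := hcap P hP
  rw [e, Set.ncard_coe_finset] at this
  omega
end
end
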